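/- arXiv:2105.13337 — 5 statements merged into one kernel-verified Lean document; each statement's English description precedes it below -/
import Mathlib

section
/- Fix c>0, d∈ℕ and m∈ℕ. There exists a constant C=C(c,d,m)>0 such that the following holds for all n and all q≥1. Let 𝓛 and 𝓛′ be probability distributions on ℝ^d satisfying d_K(𝓛,𝓛′) ≤ n^{−c}, 𝓛′((−q,q]^d)=1, and 𝓛(B) ≤ q·vol(B) for every box B all of whose side lengths are at least n^{−c}. Then: (i) for every region H⊆ℝ^d that is an intersection of at most m (closed or open) affine half-spaces, |𝓛′(H) − 𝓛(H)| ≤ C q^d n^{−c/(2d)}; and (ii) for every region R⊆ℝ^d lying between two parallel (closed or open) affine hyperplanes separated by a distance of at most n^{−c}, 𝓛(R) ≤ C q^d n^{−c/(2d)}. -/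
open Finset Filter MeasureTheory

open scoped Classical

/-- The cell with index `v` of the grid of mesh `s` whose lowest corner is `(-q, …, -q)`. -/
def gridCell {d k : ℕ} (q s : ℝ) (v : Fin d → Fin k) : Set (Fin d → ℝ) :=
  {x | ∀ i, x i ∈ Set.Ioc (-q + s * (v i : ℝ)) (-q + s * ((v i : ℝ) + 1))}

theorem measurableSet_Ioc_box {d : ℕ} (l u : Fin d → ℝ) :
    MeasurableSet {x : Fin d → ℝ | ∀ i, x i ∈ Set.Ioc (l i) (u i)} := by
  have : {x : Fin d → ℝ | ∀ i, x i ∈ Set.Ioc (l i) (u i)} =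
      Set.univ.pi fun i => Set.Ioc (l i) (u i) := by
    ext x; simp
  rw [this]
  exact MeasurableSet.univ_pi fun i => measurableSet_Ioc

theorem measurableSet_gridCell {d k : ℕ} (q s : ℝ) (v : Fin d → Fin k) :
    MeasurableSet (gridCell q s v) :=
  measurableSet_Ioc_box _ _

/-- Inclusion–exclusion over the coordinates in `S`: closeness on lower orthants gives closeness
on partially bounded boxes. -/
theorem abs_measureReal_partialBox_sub_le {d : ℕ} {L L' : Measure (Fin d → ℝ)}
    [IsProbabilityMeasure L] [IsProbabilityMeasure L'] {δ : ℝ}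
    (h : ∀ a : Fin d → ℝ, |L.real {x | ∀ i, x i ≤ a i} - L'.real {x | ∀ i, x i ≤ a i}| ≤ δ)
    (S : Finset (Fin d)) (l u : Fin d → ℝ) (hlu : ∀ i, l i ≤ u i) :
    |L.real {x | ∀ i, x i ≤ u i ∧ (i ∈ S → l i < x i)} -
      L'.real {x | ∀ i, x i ≤ u i ∧ (i ∈ S → l i < x i)}| ≤ 2 ^ #S * δ := by
  induction S using Finset.induction_on generalizing u with
  | empty => simpa using h u
  | insert j S hj ih =>
    set A : Set (Fin d → ℝ) := {x | ∀ i, x i ≤ u i ∧ (i ∈ S → l i < x i)} with hA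
    set u' := Function.update u j (l j) with hu'
    set B : Set (Fin d → ℝ) := {x | ∀ i, x i ≤ u' i ∧ (i ∈ S → l i < x i)} with hB
    have hu'j : u' j = l j := by simp [hu']
    have hu'i : ∀ i, i ≠ j → u' i = u i := fun i hi => by simp [hu', hi]
    have hle : ∀ i, u' i ≤ u i := fun i => by
      by_cases hi : i = j
      · subst hi; rw [hu'j]; exact hlu i
      · rw [hu'i i hi]
    have hlu' : ∀ i, l i ≤ u' i := fun i => by
      by_cases hi : i = j
      · subst hi; rw [hu'j]
      · rw [hu'i i hi]; exact hlu i
    have hBA : B ⊆ A := fun x hx i => ⟨(hx i).1.trans (hle i), (hx i).2⟩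
    have hBm : MeasurableSet B := by
      rw [hB, Set.ofPred_forall]
      refine MeasurableSet.iInter fun i => ?_
      have h1 : MeasurableSet {x : Fin d → ℝ | x i ≤ u' i} :=
        measurableSet_le (measurable_pi_apply i) measurable_const
      have h2 : MeasurableSet {x : Fin d → ℝ | l i < x i} :=
        measurableSet_lt measurable_const (measurable_pi_apply i)
      exact h1.inter ((MeasurableSet.const (i ∈ S)).imp h2)
    have hdiff : {x : Fin d → ℝ | ∀ i, x i ≤ u i ∧ (i ∈ insert j S → l i < x i)} = A \ B := by
      ext x
      constructor
      · intro hx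
        refine ⟨fun i => ⟨(hx i).1, fun hi => (hx i).2 (Finset.mem_insert_of_mem hi)⟩, fun hxB => ?_⟩
        have h1 := (hx j).2 (Finset.mem_insert_self _ _)
        have h2 := (hxB j).1
        rw [hu'j] at h2
        linarith
      · rintro ⟨hxA, hxB⟩ i
        refine ⟨(hxA i).1, fun hi => ?_⟩
        rcases Finset.mem_insert.1 hi with rfl | hi
        · by_contra hlt
          refine hxB fun i' => ⟨?_, (hxA i').2⟩
          by_cases hi' : i' = i
          · subst hi'; rw [hu'j]; exact not_lt.1 hlt
          · rw [hu'i i' hi']; exact (hxA i').1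
        · exact (hxA i).2 hi
    rw [hdiff, measureReal_sdiff hBA hBm, measureReal_sdiff hBA hBm, Finset.card_insert_of_notMem hj]
    have h1 := abs_le.1 (ih u hlu)
    have h2 := abs_le.1 (ih u' hlu')
    rw [abs_le, pow_succ]
    constructor <;> linarith [h1.1, h1.2, h2.1, h2.2]

theorem abs_measureReal_box_sub_le {d : ℕ} {L L' : Measure (Fin d → ℝ)}
    [IsProbabilityMeasure L] [IsProbabilityMeasure L'] {δ : ℝ}
    (h : ∀ a : Fin d → ℝ, |L.real {x | ∀ i, x i ≤ a i} - L'.real {x | ∀ i, x i ≤ a i}| ≤ δ)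
    (l u : Fin d → ℝ) (hlu : ∀ i, l i ≤ u i) :
    |L.real {x | ∀ i, x i ∈ Set.Ioc (l i) (u i)} -
      L'.real {x | ∀ i, x i ∈ Set.Ioc (l i) (u i)}| ≤ 2 ^ d * δ := by
  simpa [Set.mem_Ioc, and_comm] using abs_measureReal_partialBox_sub_le h Finset.univ l u hlu

theorem exists_mem_gridCell {d k : ℕ} {q s : ℝ} (hs : 0 < s) (hk : s * k = 2 * q)
    {x : Fin d → ℝ} (hx : ∀ i, x i ∈ Set.Ioc (-q) q) :
    ∃ v : Fin d → Fin k, x ∈ gridCell q s v := by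
  have key : ∀ i, ∃ t : Fin k, x i ∈ Set.Ioc (-q + s * (t : ℝ)) (-q + s * ((t : ℝ) + 1)) := by
    intro i
    obtain ⟨h1, h2⟩ := hx i
    have hy : 0 < (x i + q) / s := div_pos (by linarith) hs
    have hyk : (x i + q) / s ≤ k := by rw [div_le_iff₀ hs]; linarith
    have hpos : 0 < ⌈(x i + q) / s⌉₊ := Nat.ceil_pos.2 hy
    have hle : ⌈(x i + q) / s⌉₊ ≤ k := Nat.ceil_le.2 hyk
    have hlt := Nat.ceil_lt_add_one hy.le
    have hge := Nat.le_ceil ((x i + q) / s)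
    obtain ⟨t, ht⟩ := Nat.exists_eq_add_of_lt hpos
    rw [ht] at hlt hge hle
    push_cast at hlt hge
    refine ⟨⟨t, by omega⟩, ?_, ?_⟩
    · have : (t : ℝ) < (x i + q) / s := by linarith
      rw [lt_div_iff₀ hs] at this
      simp only; linarith
    · rw [div_le_iff₀ hs] at hge
      simp only; linarith
  choose v hv using key
  exact ⟨v, hv⟩

theorem pairwise_disjoint_gridCell {d k : ℕ} {q s : ℝ} (hs : 0 < s) :
    Pairwise fun v v' : Fin d → Fin k => Disjoint (gridCell q s v) (gridCell q s v') := by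
  intro v v' hvv'
  rw [Set.disjoint_left]
  intro x hx hx'
  refine hvv' (funext fun i => Fin.ext ?_)
  obtain ⟨h1, h2⟩ := hx i
  obtain ⟨h3, h4⟩ := hx' i
  have h5 : ((v i : ℕ) : ℝ) < (v' i : ℕ) + 1 := lt_of_mul_lt_mul_left (by linarith) hs.le
  have h6 : ((v' i : ℕ) : ℝ) < (v i : ℕ) + 1 := lt_of_mul_lt_mul_left (by linarith) hs.le
  norm_cast at h5 h6
  omega

theorem measureReal_le_sum_gridCell {d k : ℕ} {q s : ℝ} (hs : 0 < s) (hk : s * k = 2 * q)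
    (μ : Measure (Fin d → ℝ)) [IsProbabilityMeasure μ] (H : Set (Fin d → ℝ)) :
    μ.real H ≤ (1 - μ.real {x | ∀ i, x i ∈ Set.Ioc (-q) q}) +
      ∑ v : Fin d → Fin k with (gridCell q s v ∩ H).Nonempty, μ.real (gridCell q s v) := by
  rw [← probReal_compl_eq_one_sub (measurableSet_Ioc_box (fun _ => -q) fun _ => q)]
  refine le_trans (measureReal_mono ?_) ((measureReal_union_le _ _).trans
    (add_le_add le_rfl (measureReal_biUnion_finset_le _ _)))
  intro x hx
  by_cases hxq : ∀ i, x i ∈ Set.Ioc (-q) q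
  · obtain ⟨v, hv⟩ := exists_mem_gridCell hs hk hxq
    refine Or.inr (Set.mem_iUnion₂.2 ⟨v, ?_, hv⟩)
    exact Finset.mem_filter.2 ⟨Finset.mem_univ _, x, hv, hx⟩
  · exact Or.inl hxq

theorem sum_gridCell_le_measureReal {d k : ℕ} {q s : ℝ} (hs : 0 < s)
    (μ : Measure (Fin d → ℝ)) [IsProbabilityMeasure μ] (H : Set (Fin d → ℝ)) :
    ∑ v : Fin d → Fin k with gridCell q s v ⊆ H, μ.real (gridCell q s v) ≤ μ.real H := by
  rw [← measureReal_biUnion_finset (fun v _ v' _ h => pairwise_disjoint_gridCell hs h)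
    fun v _ => measurableSet_gridCell q s v]
  exact measureReal_mono (Set.iUnion₂_subset fun v hv => (Finset.mem_filter.1 hv).2)

theorem sum_meeting_gridCell_le {d k : ℕ} (q s : ℝ)
    (μ : Measure (Fin d → ℝ)) (H : Set (Fin d → ℝ)) :
    ∑ v : Fin d → Fin k with (gridCell q s v ∩ H).Nonempty, μ.real (gridCell q s v) ≤
      ∑ v : Fin d → Fin k with gridCell q s v ⊆ H, μ.real (gridCell q s v) +
      ∑ v : Fin d → Fin k with (gridCell q s v ∩ H).Nonempty ∧ ¬ gridCell q s v ⊆ H,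
        μ.real (gridCell q s v) := by
  simp only [Finset.sum_filter, ← Finset.sum_add_distrib]
  refine Finset.sum_le_sum fun v _ => ?_
  have := measureReal_nonneg (μ := μ) (s := gridCell q s v)
  split_ifs <;> first | linarith | tauto

/-- If every cell has nearly the same mass under both measures, then the measures of a set differ
by little more than the mass of the cells it cuts. -/
theorem abs_measureReal_sub_le_of_gridCell {d k : ℕ} {q s ε E : ℝ} (hs : 0 < s)
    (hk : s * k = 2 * q) {L L' : Measure (Fin d → ℝ)}
    [IsProbabilityMeasure L] [IsProbabilityMeasure L']
    (hcell : ∀ v : Fin d → Fin k, |L.real (gridCell q s v) - L'.real (gridCell q s v)| ≤ ε)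
    (hL' : L'.real {x | ∀ i, x i ∈ Set.Ioc (-q) q} = 1)
    (hL : 1 - L.real {x | ∀ i, x i ∈ Set.Ioc (-q) q} ≤ ε) (H : Set (Fin d → ℝ))
    (hE : ∑ v : Fin d → Fin k with (gridCell q s v ∩ H).Nonempty ∧ ¬ gridCell q s v ⊆ H,
      L.real (gridCell q s v) ≤ E) :
    |L'.real H - L.real H| ≤ (k : ℝ) ^ d * ε + ε + E := by
  have hε : 0 ≤ ε := by
    have := measureReal_le_one (μ := L) (s := {x | ∀ i, x i ∈ Set.Ioc (-q) q})
    linarith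
  have hsum : ∀ F : Finset (Fin d → Fin k), |∑ v ∈ F, L.real (gridCell q s v) -
      ∑ v ∈ F, L'.real (gridCell q s v)| ≤ (k : ℝ) ^ d * ε := by
    intro F
    rw [← Finset.sum_sub_distrib]
    refine (Finset.abs_sum_le_sum_abs _ _).trans ((Finset.sum_le_card_nsmul _ _ _ fun v _ =>
      hcell v).trans ?_)
    rw [nsmul_eq_mul]
    refine mul_le_mul_of_nonneg_right ?_ hε
    have := Finset.card_le_univ F
    simp only [Fintype.card_fun, Fintype.card_fin] at this
    exact_mod_cast this
  have hu := measureReal_le_sum_gridCell hs hk L H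
  have hu' := measureReal_le_sum_gridCell hs hk L' H
  have hl := sum_gridCell_le_measureReal (k := k) (q := q) hs L H
  have hl' := sum_gridCell_le_measureReal (k := k) (q := q) hs L' H
  have hm := sum_meeting_gridCell_le (k := k) q s L H
  have h1 := abs_le.1 (hsum {v | gridCell q s v ⊆ H})
  have h2 := abs_le.1 (hsum {v | (gridCell q s v ∩ H).Nonempty})
  rw [abs_le]
  constructor <;> linarith [h1.1, h1.2, h2.1, h2.2]

theorem Finset.card_le_of_forall_le_add {F : Finset ℕ} {D : ℕ}
    (h : ∀ a ∈ F, ∀ b ∈ F, a ≤ b + D) : #F ≤ D + 1 := by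
  rcases F.eq_empty_or_nonempty with rfl | hF
  · simp
  · have hsub : F ⊆ Finset.Icc (F.min' hF) (F.min' hF + D) := fun a ha =>
      Finset.mem_Icc.2 ⟨F.min'_le a ha, h a ha _ (F.min'_mem hF)⟩
    refine (Finset.card_le_card hsub).trans ?_
    rw [Nat.card_Icc]
    omega

/-- Few cells are cut by a thin slab: at most `2d+1` in every column in the direction of the
largest coefficient. -/
theorem card_gridCell_crossing_le {e k : ℕ} {q s : ℝ} (hs : 0 < s) (w : Fin (e + 1) → ℝ)
    (i₀ : Fin (e + 1)) (hw : ∀ i, |w i| ≤ |w i₀|) (hw0 : w i₀ ≠ 0) (b b' : ℝ)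
    (hb : b' - b ≤ (e + 1) * s * |w i₀|) (F : Finset (Fin (e + 1) → Fin k))
    (hF : ∀ v ∈ F, ∃ x ∈ gridCell q s v, ∃ y ∈ gridCell q s v,
      ∑ i, w i * x i ≤ b' ∧ b ≤ ∑ i, w i * y i) :
    #F ≤ (2 * (e + 1) + 1) * k ^ e := by
  have hcard : #(Finset.univ : Finset (Fin e → Fin k)) = k ^ e := by simp
  rw [← hcard]
  refine Finset.card_le_mul_card_image_of_maps_to (f := fun v => i₀.removeNth v)
    (fun _ _ => Finset.mem_univ _) _ fun z _ => ?_
  have hinj : Set.InjOn (fun v : Fin (e + 1) → Fin k => (v i₀ : ℕ))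
      ({v ∈ F | i₀.removeNth v = z} : Finset _) := by
    intro v hv v' hv' h
    have hz := (Finset.mem_filter.1 hv).2
    have hz' := (Finset.mem_filter.1 hv').2
    rw [← i₀.insertNth_self_removeNth v, ← i₀.insertNth_self_removeNth v', hz, hz', Fin.ext h]
  rw [← Finset.card_image_of_injOn hinj]
  have hlow : ∀ v ∈ F, ∀ v' ∈ F, i₀.removeNth v = i₀.removeNth v' →
      w i₀ * ((v i₀ : ℝ) - (v' i₀ : ℝ)) ≤ |w i₀| * (2 * (e + 1)) := by
    intro v hv v' hv' heq
    obtain ⟨x, hx, -, -, hxb, -⟩ := hF v hv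
    obtain ⟨-, -, y, hy, -, hyb⟩ := hF v' hv'
    have hterm : ∀ i, w i * (s * ((v i : ℝ) - (v' i : ℝ))) - s * |w i₀| ≤ w i * x i - w i * y i := by
      intro i
      obtain ⟨h1, h2⟩ := hx i
      obtain ⟨h3, h4⟩ := hy i
      have h5 : |s * ((v i : ℝ) - (v' i : ℝ)) - (x i - y i)| ≤ s := by
        rw [abs_le]; constructor <;> linarith
      have h6 : w i * (s * ((v i : ℝ) - (v' i : ℝ)) - (x i - y i)) ≤ |w i₀| * s :=
        (le_abs_self _).trans
            (by rw [abs_mul]; exact mul_le_mul (hw i) h5 (abs_nonneg _) (abs_nonneg _))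
      linarith
    have hsum := Finset.sum_le_sum fun i (_ : i ∈ Finset.univ) => hterm i
    have hsingle : ∑ i, w i * (s * ((v i : ℝ) - (v' i : ℝ))) =
        w i₀ * (s * ((v i₀ : ℝ) - (v' i₀ : ℝ))) := by
      refine Finset.sum_eq_single i₀ (fun i _ hi => ?_) (by simp)
      obtain ⟨j, rfl⟩ := Fin.exists_succAbove_eq hi
      have : v (i₀.succAbove j) = v' (i₀.succAbove j) := congrFun heq j
      simp [this]
    rw [Finset.sum_sub_distrib, Finset.sum_sub_distrib, hsingle] at hsum
    simp only [Finset.sum_const, Finset.card_univ, Fintype.card_fin, nsmul_eq_mul] at hsum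
    push_cast at hsum
    refine le_of_mul_le_mul_left ?_ hs
    linarith
  refine Finset.card_le_of_forall_le_add fun a ha a' ha' => ?_
  obtain ⟨v, hv, rfl⟩ := Finset.mem_image.1 ha
  obtain ⟨v', hv', rfl⟩ := Finset.mem_image.1 ha'
  obtain ⟨hvF, hvz⟩ := Finset.mem_filter.1 hv
  obtain ⟨hvF', hvz'⟩ := Finset.mem_filter.1 hv'
  have h1 := hlow v hvF v' hvF' (hvz.trans hvz'.symm)
  have h2 := hlow v' hvF' v hvF (hvz'.trans hvz.symm)
  have h3 : (v i₀ : ℝ) - (v' i₀ : ℝ) ≤ 2 * (e + 1) := by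
    refine le_of_mul_le_mul_left ?_ (abs_pos.2 hw0)
    rcases abs_cases (w i₀) with ⟨h, -⟩ | ⟨h, -⟩ <;> rw [h] at h1 h2 ⊢ <;> linarith
  have h4 : ((v i₀ : ℕ) : ℝ) ≤ ((v' i₀ : ℕ) + 2 * (e + 1) : ℕ) := by push_cast; linarith
  exact_mod_cast h4

theorem exists_forall_abs_le {e : ℕ} (w : Fin (e + 1) → ℝ) : ∃ i₀, ∀ i, |w i| ≤ |w i₀| :=
  Finite.exists_max fun i => |w i|

/-- A grid whose mesh is comparable to `σ` and divides `2q`. -/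
theorem exists_mesh {q σ : ℝ} (hq : 1 ≤ q) (hσ : 0 < σ) (hσ1 : σ ≤ 1) :
    ∃ (k : ℕ) (s : ℝ), σ ≤ s ∧ s ≤ 2 * σ ∧ s * k = 2 * q := by
  have h1 : 1 ≤ 2 * q / σ := by rw [le_div_iff₀ hσ]; linarith
  have hk1 : 1 ≤ ⌊2 * q / σ⌋₊ := Nat.one_le_floor_iff _ |>.2 h1
  have hk1' : (1 : ℝ) ≤ ⌊2 * q / σ⌋₊ := by exact_mod_cast hk1
  have hle := Nat.floor_le (zero_le_one.trans h1)
  have hlt := Nat.lt_floor_add_one (2 * q / σ)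
  have hk0 : (0 : ℝ) < ⌊2 * q / σ⌋₊ := by linarith
  rw [le_div_iff₀ hσ] at hle
  rw [div_lt_iff₀ hσ] at hlt
  refine ⟨⌊2 * q / σ⌋₊, 2 * q / ⌊2 * q / σ⌋₊, ?_, ?_, div_mul_cancel₀ _ hk0.ne'⟩
  · rw [le_div_iff₀ hk0]; linarith
  · rw [div_le_iff₀ hk0]; nlinarith

theorem sum_gridCell_le_of_card_le {e k : ℕ} {q s σ M : ℝ} (hq : 0 ≤ q) (hs : 0 ≤ s)
    (hsσ : s ≤ 2 * σ) (hk : s * k = 2 * q) (μ : Measure (Fin (e + 1) → ℝ))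
    (hcell : ∀ v : Fin (e + 1) → Fin k, μ.real (gridCell q s v) ≤ q * s ^ (e + 1))
    (F : Finset (Fin (e + 1) → Fin k)) (hM : 0 ≤ M) (hF : (#F : ℝ) ≤ M * k ^ e) :
    ∑ v ∈ F, μ.real (gridCell q s v) ≤ M * 2 ^ (e + 1) * q ^ (e + 1) * σ := by
  calc ∑ v ∈ F, μ.real (gridCell q s v) ≤ #F * (q * s ^ (e + 1)) := by
        rw [← nsmul_eq_mul]
        exact Finset.sum_le_card_nsmul _ _ _ fun v _ => hcell v
    _ ≤ M * k ^ e * (q * s ^ (e + 1)) := by gcongr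
    _ = M * q * (s * k) ^ e * s := by ring
    _ ≤ M * q * (s * k) ^ e * (2 * σ) := by gcongr
    _ = M * 2 ^ (e + 1) * q ^ (e + 1) * σ := by rw [hk]; ring

theorem abs_measureReal_gridCell_sub_le {d k : ℕ} {L L' : Measure (Fin d → ℝ)}
    [IsProbabilityMeasure L] [IsProbabilityMeasure L'] {δ q s : ℝ} (hs : 0 ≤ s)
    (h : ∀ a : Fin d → ℝ, |L.real {x | ∀ i, x i ≤ a i} - L'.real {x | ∀ i, x i ≤ a i}| ≤ δ)
    (v : Fin d → Fin k) :
    |L.real (gridCell q s v) - L'.real (gridCell q s v)| ≤ 2 ^ d * δ :=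
  abs_measureReal_box_sub_le h _ _ fun i => by linarith

theorem one_sub_measureReal_box_le {d : ℕ} {L L' : Measure (Fin d → ℝ)}
    [IsProbabilityMeasure L] [IsProbabilityMeasure L'] {δ q : ℝ} (hq : 0 ≤ q)
    (h : ∀ a : Fin d → ℝ, |L.real {x | ∀ i, x i ≤ a i} - L'.real {x | ∀ i, x i ≤ a i}| ≤ δ)
    (hL' : L'.real {x | ∀ i, x i ∈ Set.Ioc (-q) q} = 1) :
    1 - L.real {x | ∀ i, x i ∈ Set.Ioc (-q) q} ≤ 2 ^ d * δ := by
  have := (abs_le.1 (abs_measureReal_box_sub_le h (fun _ => -q) (fun _ => q)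
    fun _ => by linarith)).1
  rw [hL'] at this
  linarith

theorem measureReal_gridCell_le {d k : ℕ} {L : Measure (Fin d → ℝ)} {δ q s : ℝ} (hδs : δ ≤ s)
    (h : ∀ l u : Fin d → ℝ, (∀ i, δ ≤ u i - l i) →
      L.real {x | ∀ i, x i ∈ Set.Ioc (l i) (u i)} ≤ q * ∏ i, (u i - l i))
    (v : Fin d → Fin k) : L.real (gridCell q s v) ≤ q * s ^ d := by
  have hsub : ∀ i, (-q + s * ((v i : ℝ) + 1)) - (-q + s * (v i : ℝ)) = s := fun i => by ring
  have := h (fun i => -q + s * (v i : ℝ)) (fun i => -q + s * ((v i : ℝ) + 1))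
    fun i => by rw [hsub]; exact hδs
  simp only [hsub, Finset.prod_const, Finset.card_univ, Fintype.card_fin] at this
  exact this

theorem abs_measureReal_sub_le_of_cut {e m k : ℕ} {q s σ δ : ℝ} (hq : 1 ≤ q) (hσ : 0 < σ)
    (hσ1 : σ ≤ 1) (hδ : δ = σ ^ (2 * (e + 1))) (hσs : σ ≤ s) (hsσ : s ≤ 2 * σ)
    (hk : s * k = 2 * q) {L L' : Measure (Fin (e + 1) → ℝ)}
    [IsProbabilityMeasure L] [IsProbabilityMeasure L']
    (h : ∀ a : Fin (e + 1) → ℝ,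
      |L.real {x | ∀ i, x i ≤ a i} - L'.real {x | ∀ i, x i ≤ a i}| ≤ δ)
    (hL' : L'.real {x | ∀ i, x i ∈ Set.Ioc (-q) q} = 1)
    (hcell : ∀ v : Fin (e + 1) → Fin k, L.real (gridCell q s v) ≤ q * s ^ (e + 1))
    {m' : ℕ} (hm : m' ≤ m) (w : Fin m' → Fin (e + 1) → ℝ) (b : Fin m' → ℝ) (hw : ∀ j, w j ≠ 0)
    (H : Set (Fin (e + 1) → ℝ)) (hH : ∀ x ∈ H, ∀ j, ∑ i, w j i * x i ≤ b j)
    (hHc : ∀ x ∉ H, ∃ j, b j ≤ ∑ i, w j i * x i) :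
    |L'.real H - L.real H| ≤
      (4 ^ (e + 1) + 2 ^ (e + 1) + m * (2 * (e + 1) + 1) * 2 ^ (e + 1)) * q ^ (e + 1) * σ := by
  have hs : 0 < s := hσ.trans_le hσs
  have hq0 : 0 ≤ q := zero_le_one.trans hq
  set F : Finset (Fin (e + 1) → Fin k) :=
    {v | (gridCell q s v ∩ H).Nonempty ∧ ¬ gridCell q s v ⊆ H} with hF
  let G : Fin m' → Finset (Fin (e + 1) → Fin k) := fun j =>
    {v | ∃ x ∈ gridCell q s v, ∃ y ∈ gridCell q s v,
      ∑ i, w j i * x i ≤ b j ∧ b j ≤ ∑ i, w j i * y i}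
  have hG : ∀ j, #(G j) ≤ (2 * (e + 1) + 1) * k ^ e := by
    intro j
    obtain ⟨i₀, hi₀⟩ := exists_forall_abs_le (w j)
    have hne : w j i₀ ≠ 0 := by
      intro h0
      refine hw j (funext fun i => ?_)
      have := hi₀ i
      rw [h0, abs_zero] at this
      exact abs_nonpos_iff.1 this
    exact card_gridCell_crossing_le hs (w j) i₀ hi₀ hne (b j) (b j)
      (by rw [sub_self]; positivity) _ fun v hv => (Finset.mem_filter.1 hv).2
  have hFG : F ⊆ Finset.univ.biUnion G := by
    intro v hv
    obtain ⟨⟨x, hx, hxH⟩, hsub⟩ := (Finset.mem_filter.1 hv).2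
    obtain ⟨y, hy, hyH⟩ := Set.not_subset.1 hsub
    obtain ⟨j, hj⟩ := hHc y hyH
    exact Finset.mem_biUnion.2 ⟨j, Finset.mem_univ _, Finset.mem_filter.2
      ⟨Finset.mem_univ _, x, hx, y, hy, hH x hxH j, hj⟩⟩
  have hFcard : #F ≤ m * (2 * (e + 1) + 1) * k ^ e := by
    refine (Finset.card_le_card hFG).trans ((Finset.card_biUnion_le_card_mul _ _ _
      fun j _ => hG j).trans ?_)
    rw [Finset.card_univ, Fintype.card_fin, mul_assoc]
    gcongr
  have hE := sum_gridCell_le_of_card_le (M := m * (2 * (e + 1) + 1)) hq0 hs.le hsσ hk L hcell F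
    (by positivity) (by exact_mod_cast hFcard)
  refine (abs_measureReal_sub_le_of_gridCell hs hk
    (abs_measureReal_gridCell_sub_le hs.le h) hL'
    (one_sub_measureReal_box_le hq0 h hL') H hE).trans ?_
  have hσp : σ ^ (e + 1) ≤ σ := pow_le_of_le_one hσ.le hσ1 (by omega)
  have hδσ : δ ≤ σ := by rw [hδ]; exact pow_le_of_le_one hσ.le hσ1 (by omega)
  have h1 : (k : ℝ) ^ (e + 1) * (2 ^ (e + 1) * δ) ≤ 4 ^ (e + 1) * q ^ (e + 1) * σ := by
    calc (k : ℝ) ^ (e + 1) * (2 ^ (e + 1) * δ)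
        = 2 ^ (e + 1) * (σ * k) ^ (e + 1) * σ ^ (e + 1) := by rw [hδ]; ring
      _ ≤ 2 ^ (e + 1) * (s * k) ^ (e + 1) * σ := by gcongr
      _ = 4 ^ (e + 1) * q ^ (e + 1) * σ := by
        rw [hk, mul_pow, show (4 : ℝ) = 2 * 2 by norm_num, mul_pow]; ring
  have h2 : 2 ^ (e + 1) * δ ≤ 2 ^ (e + 1) * q ^ (e + 1) * σ := by
    have : 1 ≤ q ^ (e + 1) := one_le_pow₀ hq
    calc 2 ^ (e + 1) * δ ≤ 2 ^ (e + 1) * 1 * σ := by rw [mul_one]; gcongr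
      _ ≤ _ := by gcongr
  linarith

theorem measureReal_le_of_slab {e k : ℕ} {q s σ δ : ℝ} (hq : 1 ≤ q) (hσ : 0 < σ) (hδσ : δ ≤ σ) (hσs : σ ≤ s) (hsσ : s ≤ 2 * σ)
    (hk : s * k = 2 * q) {L L' : Measure (Fin (e + 1) → ℝ)}
    [IsProbabilityMeasure L] [IsProbabilityMeasure L']
    (h : ∀ a : Fin (e + 1) → ℝ,
      |L.real {x | ∀ i, x i ≤ a i} - L'.real {x | ∀ i, x i ≤ a i}| ≤ δ)
    (hL' : L'.real {x | ∀ i, x i ∈ Set.Ioc (-q) q} = 1)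
    (hcell : ∀ v : Fin (e + 1) → Fin k, L.real (gridCell q s v) ≤ q * s ^ (e + 1))
    (R : Set (Fin (e + 1) → ℝ)) (w : Fin (e + 1) → ℝ) (b b' : ℝ)
    (hw : ∑ i, w i ^ 2 = 1) (hb : b' - b ≤ δ)
    (hR : ∀ x ∈ R, b ≤ ∑ i, w i * x i ∧ ∑ i, w i * x i ≤ b') :
    L.real R ≤ (2 ^ (e + 1) + (2 * (e + 1) + 1) * 2 ^ (e + 1)) * q ^ (e + 1) * σ := by
  have hs : 0 < s := hσ.trans_le hσs
  have hq0 : 0 ≤ q := zero_le_one.trans hq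
  obtain ⟨i₀, hi₀⟩ := exists_forall_abs_le w
  have hle1 : |w i₀| ≤ 1 := by
    rw [← sq_le_one_iff_abs_le_one, ← hw]
    exact Finset.single_le_sum (f := fun i => w i ^ 2) (fun i _ => sq_nonneg _)
      (Finset.mem_univ i₀)
  have hge : 1 ≤ (e + 1) * |w i₀| := by
    calc 1 = ∑ i, w i ^ 2 := hw.symm
      _ ≤ ∑ _i : Fin (e + 1), |w i₀| := Finset.sum_le_sum fun i _ => by
        rw [← sq_abs]
        nlinarith [hi₀ i, abs_nonneg (w i)]
      _ = (e + 1) * |w i₀| := by simp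
  have hne : w i₀ ≠ 0 := by
    intro h0
    rw [h0, abs_zero, mul_zero] at hge
    linarith
  have hF := card_gridCell_crossing_le (k := k) (q := q) hs w i₀ hi₀ hne b b' (by nlinarith)
    {v | (gridCell q s v ∩ R).Nonempty} fun v hv => by
      obtain ⟨x, hx, hxR⟩ := (Finset.mem_filter.1 hv).2
      exact ⟨x, hx, x, hx, (hR x hxR).2, (hR x hxR).1⟩
  have hE := sum_gridCell_le_of_card_le (M := 2 * (e + 1) + 1) hq0 hs.le hsσ hk L hcell _
    (by positivity) (by exact_mod_cast hF)
  have h2 : 2 ^ (e + 1) * δ ≤ 2 ^ (e + 1) * q ^ (e + 1) * σ := by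
    have : 1 ≤ q ^ (e + 1) := one_le_pow₀ hq
    calc 2 ^ (e + 1) * δ ≤ 2 ^ (e + 1) * 1 * σ := by rw [mul_one]; gcongr
      _ ≤ _ := by gcongr
  have := measureReal_le_sum_gridCell hs hk L R
  have := one_sub_measureReal_box_le hq0 h hL'
  linarith

/-- Kolmogorov-close distributions assign similar mass to intersections of
half-spaces, and anticoncentrated distributions give little mass to thin slabs. The
Kolmogorov distance hypothesis `d_K(𝓛,𝓛') ≤ n^{-c}` is expressed pointwise over lower sets,
boxes are products of half-open intervals, a (closed or open) affine half-space is
`{x | ⟨w,x⟩ ≤ b}` or `{x | ⟨w,x⟩ < b}` with `w ≠ 0`, and a region between two parallel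
hyperplanes at distance `≤ n^{-c}` is a set `R` with `b ≤ ⟨w,x⟩ ≤ b'` for all `x ∈ R`,
where `‖w‖ = 1` and `b' - b ≤ n^{-c}`. -/
theorem statement8 (c : ℝ) (hc : 0 < c) (d : ℕ) (m : ℕ) :
    ∃ C : ℝ, 0 < C ∧
    ∀ (n : ℕ), 0 < n → ∀ (q : ℝ), 1 ≤ q →
    ∀ (L L' : Measure (Fin d → ℝ)),
      IsProbabilityMeasure L → IsProbabilityMeasure L' →
      (∀ a : Fin d → ℝ,
        |(L {x | ∀ i, x i ≤ a i}).toReal - (L' {x | ∀ i, x i ≤ a i}).toReal| ≤ (n : ℝ) ^ (-c)) →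
      (L' {x | ∀ i, x i ∈ Set.Ioc (-q) q}).toReal = 1 →
      (∀ l u : Fin d → ℝ, (∀ i, (n : ℝ) ^ (-c) ≤ u i - l i) →
        (L {x | ∀ i, x i ∈ Set.Ioc (l i) (u i)}).toReal ≤ q * ∏ i, (u i - l i)) →
      -- (i) intersections of at most m closed or open affine half-spaces
      (∀ (m' : ℕ), m' ≤ m → ∀ (w : Fin m' → Fin d → ℝ) (b : Fin m' → ℝ) (op : Fin m' → Bool),
        (∀ j, w j ≠ 0) →
        |(L' {x | ∀ j, if op j then (∑ i, w j i * x i) < b j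
              else (∑ i, w j i * x i) ≤ b j}).toReal -
            (L {x | ∀ j, if op j then (∑ i, w j i * x i) < b j
              else (∑ i, w j i * x i) ≤ b j}).toReal| ≤
          C * q ^ d * (n : ℝ) ^ (-c / (2 * d))) ∧
      -- (ii) regions between two parallel hyperplanes at distance at most n^{-c}
      (∀ (R : Set (Fin d → ℝ)) (w : Fin d → ℝ) (b b' : ℝ),
        Real.sqrt (∑ i, (w i) ^ 2) = 1 → b' - b ≤ (n : ℝ) ^ (-c) →
        (∀ x ∈ R, b ≤ ∑ i, w i * x i ∧ ∑ i, w i * x i ≤ b') →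
        (L R).toReal ≤ C * q ^ d * (n : ℝ) ^ (-c / (2 * d))) := by
  refine ⟨4 ^ d + 2 ^ d + (m + 1) * (2 * d + 1) * 2 ^ d, by positivity, ?_⟩
  intro n hn q hq L L' _ _ hK hbox hanti
  have hn1 : (1 : ℝ) ≤ n := by exact_mod_cast hn
  have hn0 : (0 : ℝ) < n := by linarith
  rcases d with _ | e
  · have hC : (1 : ℝ) ≤ (4 ^ 0 + 2 ^ 0 + (m + 1) * (2 * (0 : ℕ) + 1) * 2 ^ 0) * q ^ 0 *
        (n : ℝ) ^ (-c / (2 * (0 : ℕ))) := by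
      have : (0 : ℝ) ≤ m := m.cast_nonneg
      simp
      linarith
    have hle : ∀ (μ : Measure (Fin 0 → ℝ)) [IsProbabilityMeasure μ] A,
        0 ≤ (μ A).toReal ∧ (μ A).toReal ≤ 1 :=
      fun μ _ A => ⟨measureReal_nonneg, measureReal_le_one⟩
    refine ⟨fun m' _ w b op _ => le_trans ?_ hC, fun R _ _ _ _ _ _ => (hle L R).2.trans hC⟩
    exact abs_sub_le_of_nonneg_of_le (hle L' _).1 (hle L' _).2 (hle L _).1 (hle L _).2
  · set σ : ℝ := (n : ℝ) ^ (-c / (2 * (e + 1 : ℕ))) with hσ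
    have hσ0 : 0 < σ := Real.rpow_pos_of_pos hn0 _
    have hσ1 : σ ≤ 1 := Real.rpow_le_one_of_one_le_of_nonpos hn1
      (div_nonpos_of_nonpos_of_nonneg (by linarith) (by positivity))
    have hδ : (n : ℝ) ^ (-c) = σ ^ (2 * (e + 1)) := by
      rw [hσ, ← Real.rpow_natCast, ← Real.rpow_mul hn0.le]
      congr 1
      push_cast
      field_simp
    have hδσ : (n : ℝ) ^ (-c) ≤ σ := by
      rw [hδ]; exact pow_le_of_le_one hσ0.le hσ1 (by omega)
    obtain ⟨k, s, hσs, hsσ, hk⟩ := exists_mesh hq hσ0 hσ1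
    have hcell : ∀ v : Fin (e + 1) → Fin k, L.real (gridCell q s v) ≤ q * s ^ (e + 1) :=
      measureReal_gridCell_le (hδσ.trans hσs) hanti
    have hm0 : (0 : ℝ) ≤ m := m.cast_nonneg
    refine ⟨fun m' hm' w b op hw => ?_, fun R w b b' hw hb hR => ?_⟩
    · refine (abs_measureReal_sub_le_of_cut hq hσ0 hσ1 hδ hσs hsσ hk hK hbox hcell hm' w b hw _
        (fun x hx j => ?_) fun x hx => ?_).trans ?_
      · have := hx j
        split_ifs at this
        exacts [this.le, this]
      · obtain ⟨j, hj⟩ := not_forall.1 hx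
        refine ⟨j, ?_⟩
        split_ifs at hj
        exacts [not_lt.1 hj, (not_le.1 hj).le]
      · push_cast
        gcongr
        linarith
    · refine (measureReal_le_of_slab hq hσ0 hδσ hσs hsσ hk hK hbox hcell R w b b'
        (Real.sqrt_eq_one.1 hw) hb hR).trans ?_
      have h4 : (0 : ℝ) ≤ 4 ^ (e + 1) := by positivity
      have h1 : (1 : ℝ) * ((2 * (e + 1) + 1) * 2 ^ (e + 1)) ≤
          (m + 1) * ((2 * (e + 1) + 1) * 2 ^ (e + 1)) := by
        gcongr
        linarith
      push_cast
      refine mul_le_mul_of_nonneg_right (mul_le_mul_of_nonneg_right ?_ (by positivity)) hσ0.le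
      linarith
end

section
/- There are absolute constants C, c > 0 such that for every n, a random graph G ~ G(n,1/2) satisfies, with probability at least 1−2exp(−cn), the following for all pairs of disjoint vertex subsets S and T: (i) Σ_{v∈T}(deg_S(v)−|S|/2)² ≤ Cn²; (ii) Σ_{v∈T}(deg_T(v)−(|T|−1)/2)² ≤ Cn²; (iii) |Σ_{v∈T}(deg_S(v)−|S|/2)| ≤ Cn^{3/2}; and (iv) |Σ_{v∈T}(deg_T(v)−(|T|−1)/2)| ≤ Cn^{3/2}. -/
open Finset Filter

open scoped Classical

/-- The number of neighbours of `v` (in the graph `G`) lying in the set `S`. -/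
noncomputable def degIn {n : ℕ} (G : SimpleGraph (Fin n)) (S : Finset (Fin n)) (v : Fin n) : ℕ :=
  (S.filter fun w => G.Adj v w).card

/-- The friendliness of a vertex `v` with respect to the bisection `A ∪ Aᶜ`:
the number of neighbours in its own part minus the number of neighbours across. -/
noncomputable def friendliness {n : ℕ} (G : SimpleGraph (Fin n)) (A : Finset (Fin n))
    (v : Fin n) : ℤ :=
  if v ∈ A then (degIn G A v : ℤ) - (degIn G Aᶜ v : ℤ)
  else (degIn G Aᶜ v : ℤ) - (degIn G A v : ℤ)

/-- `A ∪ Aᶜ` is a bisection: the parts' sizes differ by at most one. -/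
def IsBisection {n : ℕ} (A : Finset (Fin n)) : Prop :=
  |(A.card : ℤ) - (Aᶜ.card : ℤ)| ≤ 1

/-- The probability, under the uniform measure on simple graphs on `Fin n`
(i.e. the Erdős–Rényi measure `G(n,1/2)`), of the set of graphs satisfying `P`. -/
noncomputable def graphProb (n : ℕ) (P : SimpleGraph (Fin n) → Prop) : ℝ :=
  ((univ.filter P).card : ℝ) / (Fintype.card (SimpleGraph (Fin n)) : ℝ)

/-- The `±1` indicator of adjacency. -/
noncomputable def adjSign {n : ℕ} (G : SimpleGraph (Fin n)) (v w : Fin n) : ℝ :=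
  if G.Adj v w then 1 else -1

/-- The graph `G` with the status of the pair `{v, w}` toggled. -/
noncomputable def toggleEdge {n : ℕ} (v w : Fin n) (G : SimpleGraph (Fin n)) :
    SimpleGraph (Fin n) :=
  symmDiff G (SimpleGraph.edge v w)

lemma toggleEdge_involutive {n : ℕ} (v w : Fin n) :
    Function.Involutive (toggleEdge v w) := fun G => by
  simp [toggleEdge]

lemma adjSign_toggleEdge_self {n : ℕ} {v w : Fin n} (h : v ≠ w) (G : SimpleGraph (Fin n)) :
    adjSign (toggleEdge v w G) v w = -adjSign G v w := by
  by_cases hG : G.Adj v w <;>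
    simp [adjSign, toggleEdge, symmDiff_def, SimpleGraph.edge_adj, h, hG]

lemma adjSign_toggleEdge_of_ne {n : ℕ} {v w a b : Fin n} (h : s(a, b) ≠ s(v, w))
    (G : SimpleGraph (Fin n)) :
    adjSign (toggleEdge v w G) a b = adjSign G a b := by
  have h' : ¬ (SimpleGraph.edge v w).Adj a b := by
    rw [SimpleGraph.edge_adj]
    rintro ⟨h1, -⟩
    apply h
    rw [Sym2.eq_iff]
    tauto
  simp [adjSign, toggleEdge, symmDiff_def, h']

lemma adjSign_sq {n : ℕ} (G : SimpleGraph (Fin n)) (v w : Fin n) : adjSign G v w ^ 2 = 1 := by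
  unfold adjSign
  split_ifs <;> norm_num

/-- Averaging `exp ((y + ε) ^ 2 / c)` over a random sign `ε` costs little. -/
lemma exp_sq_add_exp_sq_le {c y s : ℝ} (hc : 2 < c) (hs : s ^ 2 = 1) :
    Real.exp ((y + s) ^ 2 / c) + Real.exp ((y - s) ^ 2 / c) ≤
      2 * (Real.exp (1 / c) * Real.exp (y ^ 2 / (c - 2))) := by
  have h1 : (y + s) ^ 2 / c = (y ^ 2 + 1) / c + 2 * y * s / c := by
    rw [← hs]; ring
  have h2 : (y - s) ^ 2 / c = (y ^ 2 + 1) / c + -(2 * y * s / c) := by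
    rw [← hs]; ring
  have h3 := Real.cosh_le_exp_half_sq (2 * y * s / c)
  rw [Real.cosh_eq] at h3
  have h4 : (2 * y * s / c) ^ 2 / 2 = 2 * y ^ 2 / c ^ 2 := by
    rw [div_pow, mul_pow, hs]; ring
  have hc0 : 0 < c := by linarith
  have hc2 : 0 < c - 2 := by linarith
  have h5 : (y ^ 2 + 1) / c + 2 * y ^ 2 / c ^ 2 ≤ 1 / c + y ^ 2 / (c - 2) := by
    have : 1 / c + y ^ 2 / (c - 2) - ((y ^ 2 + 1) / c + 2 * y ^ 2 / c ^ 2) =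
        4 * y ^ 2 / (c ^ 2 * (c - 2)) := by
      field_simp
      ring
    have h0 : 0 ≤ 4 * y ^ 2 / (c ^ 2 * (c - 2)) := by positivity
    linarith
  rw [h1, h2, Real.exp_add, Real.exp_add, ← mul_add, ← Real.exp_add]
  calc _ ≤ Real.exp ((y ^ 2 + 1) / c) * (2 * Real.exp (2 * y ^ 2 / c ^ 2)) := by
        rw [h4] at h3
        gcongr
        linarith
    _ = 2 * Real.exp ((y ^ 2 + 1) / c + 2 * y ^ 2 / c ^ 2) := by
        rw [Real.exp_add]; ring
    _ ≤ _ := by gcongr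

lemma sum_mul_exp_add_adjSign_sq_le {n : ℕ} {v w : Fin n} (h : v ≠ w) {c : ℝ} (hc : 2 < c)
    (Φ Y : SimpleGraph (Fin n) → ℝ) (hΦ0 : ∀ G, 0 ≤ Φ G)
    (hΦ : ∀ G, Φ (toggleEdge v w G) = Φ G) (hY : ∀ G, Y (toggleEdge v w G) = Y G) :
    ∑ G, Φ G * Real.exp ((Y G + adjSign G v w) ^ 2 / c) ≤
      Real.exp (1 / c) * ∑ G, Φ G * Real.exp (Y G ^ 2 / (c - 2)) := by
  have e : ∑ G, Φ G * Real.exp ((Y G + adjSign G v w) ^ 2 / c) =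
      ∑ G, Φ G * Real.exp ((Y G - adjSign G v w) ^ 2 / c) := by
    rw [← Equiv.sum_comp (toggleEdge_involutive v w).toPerm]
    refine Finset.sum_congr rfl fun G _ => ?_
    simp only [Function.Involutive.coe_toPerm, hΦ, hY, adjSign_toggleEdge_self h, sub_eq_add_neg]
  have k : ∑ G, Φ G * Real.exp ((Y G + adjSign G v w) ^ 2 / c) +
      ∑ G, Φ G * Real.exp ((Y G - adjSign G v w) ^ 2 / c) ≤
      2 * (Real.exp (1 / c) * ∑ G, Φ G * Real.exp (Y G ^ 2 / (c - 2))) := by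
    rw [← Finset.sum_add_distrib, Finset.mul_sum, Finset.mul_sum]
    refine Finset.sum_le_sum fun G _ => ?_
    have := mul_le_mul_of_nonneg_left
      (exp_sq_add_exp_sq_le (y := Y G) hc (adjSign_sq G v w)) (hΦ0 G)
    linarith
  linarith

lemma sum_mul_exp_star_sq_le {n : ℕ} (v : Fin n) {m : ℝ} (hm : 0 < m)
    (Φ : SimpleGraph (Fin n) → ℝ) (hΦ0 : ∀ G, 0 ≤ Φ G) (D : Finset (Fin n)) :
    ∀ c : ℝ, 2 * m + 2 * (D.card : ℝ) ≤ c → v ∉ D →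
      (∀ w ∈ D, ∀ G, Φ (toggleEdge v w G) = Φ G) →
      ∑ G, Φ G * Real.exp ((∑ w ∈ D, adjSign G v w) ^ 2 / c) ≤
        Real.exp (D.card / (2 * m)) * ∑ G, Φ G := by
  induction D using Finset.induction_on with
  | empty => intro c _ _ _; simp
  | insert w D hw ih =>
    intro c hc hv hΦ
    rw [Finset.card_insert_of_notMem hw] at hc ⊢
    push_cast at hc ⊢
    have hvw : v ≠ w := fun h => hv (h ▸ Finset.mem_insert_self _ _)
    have hD : (0 : ℝ) ≤ D.card := by positivity
    have hstep := sum_mul_exp_add_adjSign_sq_le hvw (c := c) (by linarith) Φ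
      (fun G => ∑ x ∈ D, adjSign G v x) hΦ0 (hΦ w (Finset.mem_insert_self _ _)) (fun G => by
        refine Finset.sum_congr rfl fun x hx => adjSign_toggleEdge_of_ne ?_ G
        intro h
        rw [Sym2.congr_right] at h
        exact hw (h ▸ hx))
    have hih := ih (c - 2) (by linarith) (fun h => hv (Finset.mem_insert_of_mem h))
      (fun x hx => hΦ x (Finset.mem_insert_of_mem hx))
    have hS : 0 ≤ ∑ G, Φ G := Finset.sum_nonneg fun G _ => hΦ0 G
    calc _ = ∑ G, Φ G * Real.exp ((∑ x ∈ D, adjSign G v x + adjSign G v w) ^ 2 / c) := by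
          refine Finset.sum_congr rfl fun G _ => ?_
          rw [Finset.sum_insert hw, add_comm]
      _ ≤ _ := hstep
      _ ≤ Real.exp (1 / c) * (Real.exp (D.card / (2 * m)) * ∑ G, Φ G) := by gcongr
      _ ≤ Real.exp (1 / (2 * m)) * (Real.exp (D.card / (2 * m)) * ∑ G, Φ G) := by
          gcongr
          linarith
      _ = _ := by
          rw [← mul_assoc, ← Real.exp_add, ← add_div, add_comm (1 : ℝ)]

/-- Exponential moment bound for the sum of squares of sign sums over pairwise edge-disjoint
stars. -/
lemma sum_exp_stars_sq_le {n : ℕ} (hn : 0 < n) (D : Fin n → Finset (Fin n))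
    (hD : ∀ v w, w ∈ D v → v ∉ D w) (R : Finset (Fin n)) :
    ∑ G : SimpleGraph (Fin n),
        Real.exp (∑ v ∈ R, (∑ w ∈ D v, adjSign G v w) ^ 2 / (4 * (n : ℝ))) ≤
      Real.exp (R.card / 2) * Fintype.card (SimpleGraph (Fin n)) := by
  have hn' : (0 : ℝ) < n := by exact_mod_cast hn
  induction R using Finset.induction_on with
  | empty => simp
  | insert v R hv ih =>
    have hcard : ((D v).card : ℝ) ≤ n := by
      exact_mod_cast (Finset.card_le_univ (D v)).trans_eq (Fintype.card_fin n)
    have hrow := sum_mul_exp_star_sq_le v hn'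
      (fun G => Real.exp (∑ u ∈ R, (∑ w ∈ D u, adjSign G u w) ^ 2 / (4 * (n : ℝ))))
      (fun G => (Real.exp_pos _).le) (D v) (4 * n) (by linarith) (fun h => hD v v h h) (by
        intro w hw G
        congr 1
        refine Finset.sum_congr rfl fun u hu => ?_
        congr 2
        refine Finset.sum_congr rfl fun x hx => adjSign_toggleEdge_of_ne ?_ G
        intro h
        rw [Sym2.eq_iff] at h
        rcases h with ⟨rfl, -⟩ | ⟨rfl, rfl⟩
        · exact hv hu
        · exact hD _ _ hw hx)
    calc _ = ∑ G : SimpleGraph (Fin n),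
          Real.exp (∑ u ∈ R, (∑ w ∈ D u, adjSign G u w) ^ 2 / (4 * (n : ℝ))) *
            Real.exp ((∑ w ∈ D v, adjSign G v w) ^ 2 / (4 * (n : ℝ))) := by
          refine Finset.sum_congr rfl fun G _ => ?_
          rw [Finset.sum_insert hv, ← Real.exp_add, add_comm]
      _ ≤ _ := hrow
      _ ≤ Real.exp (1 / 2) *
          (Real.exp (R.card / 2) * Fintype.card (SimpleGraph (Fin n))) := by
          have : ((D v).card : ℝ) / (2 * n) ≤ 1 / 2 := by
            rw [div_le_div_iff₀ (by positivity) (by norm_num)]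
            linarith
          gcongr
      _ = _ := by
          rw [Finset.card_insert_of_notMem hv, ← mul_assoc, ← Real.exp_add]
          push_cast
          ring_nf

lemma card_filter_stars_sq_le {n : ℕ} (hn : 0 < n) (D : Fin n → Finset (Fin n))
    (hD : ∀ v w, w ∈ D v → v ∉ D w) :
    ((univ.filter fun G : SimpleGraph (Fin n) =>
        10 * (n : ℝ) ^ 2 < ∑ v, (∑ w ∈ D v, adjSign G v w) ^ 2).card : ℝ) ≤
      Real.exp (-2 * n) * Fintype.card (SimpleGraph (Fin n)) := by
  have hn' : (0 : ℝ) < n := by exact_mod_cast hn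
  have hmom := sum_exp_stars_sq_le hn D hD univ
  rw [Finset.card_univ, Fintype.card_fin] at hmom
  set B := univ.filter fun G : SimpleGraph (Fin n) =>
    10 * (n : ℝ) ^ 2 < ∑ v, (∑ w ∈ D v, adjSign G v w) ^ 2 with hB
  have hmarkov : (B.card : ℝ) * Real.exp (5 / 2 * n) ≤
      Real.exp (n / 2) * Fintype.card (SimpleGraph (Fin n)) := by
    refine le_trans ?_ hmom
    rw [← nsmul_eq_mul, ← Finset.sum_const]
    refine le_trans (Finset.sum_le_sum fun G hG => ?_)
      (Finset.sum_le_sum_of_subset_of_nonneg (Finset.subset_univ B)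
        fun G _ _ => (Real.exp_pos _).le)
    rw [hB, Finset.mem_filter] at hG
    rw [← Finset.sum_div]
    gcongr
    rw [le_div_iff₀ (by positivity)]
    nlinarith [hG.2]
  calc (B.card : ℝ) = B.card * Real.exp (5 / 2 * n) * Real.exp (-(5 / 2 * n)) := by
        rw [mul_assoc, ← Real.exp_add]; simp
    _ ≤ Real.exp (n / 2) * Fintype.card (SimpleGraph (Fin n)) * Real.exp (-(5 / 2 * n)) := by
        gcongr
    _ = _ := by
        rw [mul_right_comm, ← Real.exp_add]
        ring_nf

lemma degIn_sub_half_eq {n : ℕ} (G : SimpleGraph (Fin n)) (S : Finset (Fin n)) (v : Fin n) :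
    (degIn G S v : ℝ) - ((S.erase v).card : ℝ) / 2 =
      (∑ w ∈ S with v < w, adjSign G v w + ∑ w ∈ S with w < v, adjSign G v w) / 2 := by
  have h1 : (degIn G S v : ℝ) = ∑ w ∈ S, if G.Adj v w then 1 else 0 := by
    simp [degIn]
  have h2 : ((S.erase v).card : ℝ) = ∑ w ∈ S, if w ≠ v then 1 else 0 := by
    rw [Finset.sum_boole, Finset.filter_ne']
  rw [h1, h2, Finset.sum_filter, Finset.sum_filter, ← Finset.sum_add_distrib, Finset.sum_div,
    Finset.sum_div, ← Finset.sum_sub_distrib]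
  refine Finset.sum_congr rfl fun w _ => ?_
  rcases lt_trichotomy v w with h | rfl | h
  · by_cases hG : G.Adj v w <;> simp [adjSign, hG, h, h.not_gt, h.ne'] <;> norm_num
  · simp
  · by_cases hG : G.Adj v w <;> simp [adjSign, hG, h, h.not_gt, h.ne] <;> norm_num

lemma abs_sum_le_rpow_of_sum_sq_le {n : ℕ} (T : Finset (Fin n)) (f : Fin n → ℝ)
    (h : ∑ v ∈ T, f v ^ 2 ≤ 10 * (n : ℝ) ^ 2) :
    |∑ v ∈ T, f v| ≤ 10 * (n : ℝ) ^ (3 / 2 : ℝ) := by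
  have hT : (T.card : ℝ) ≤ n := by
    exact_mod_cast (Finset.card_le_univ T).trans_eq (Fintype.card_fin n)
  have hn : (0 : ℝ) ≤ n := by positivity
  refine abs_le_of_sq_le_sq ?_ (by positivity)
  have hr : ((n : ℝ) ^ (3 / 2 : ℝ)) ^ 2 = (n : ℝ) ^ 3 := by
    rw [← Real.rpow_natCast, ← Real.rpow_mul hn, ← Real.rpow_natCast]
    norm_num
  calc (∑ v ∈ T, f v) ^ 2 ≤ T.card * ∑ v ∈ T, f v ^ 2 := sq_sum_le_card_mul_sum_sq
    _ ≤ n * (10 * (n : ℝ) ^ 2) := by gcongr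
    _ ≤ (10 * (n : ℝ) ^ (3 / 2 : ℝ)) ^ 2 := by
        rw [mul_pow, hr]
        nlinarith [pow_nonneg hn 3]

lemma sum_degIn_sub_half_sq_le {n : ℕ} {G : SimpleGraph (Fin n)} {S : Finset (Fin n)}
    (hup : ∑ v, (∑ w ∈ S with v < w, adjSign G v w) ^ 2 ≤ 10 * (n : ℝ) ^ 2)
    (hdown : ∑ v, (∑ w ∈ S with w < v, adjSign G v w) ^ 2 ≤ 10 * (n : ℝ) ^ 2)
    (T : Finset (Fin n)) :
    ∑ v ∈ T, ((degIn G S v : ℝ) - ((S.erase v).card : ℝ) / 2) ^ 2 ≤ 10 * (n : ℝ) ^ 2 := by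
  calc _ ≤ ∑ v, ((degIn G S v : ℝ) - ((S.erase v).card : ℝ) / 2) ^ 2 :=
        Finset.sum_le_sum_of_subset_of_nonneg (Finset.subset_univ T) fun v _ _ => sq_nonneg _
    _ ≤ ∑ v, ((∑ w ∈ S with v < w, adjSign G v w) ^ 2 +
          (∑ w ∈ S with w < v, adjSign G v w) ^ 2) / 2 := by
        refine Finset.sum_le_sum fun v _ => ?_
        rw [degIn_sub_half_eq]
        nlinarith [sq_nonneg (∑ w ∈ S with v < w, adjSign G v w -
          ∑ w ∈ S with w < v, adjSign G v w)]
    _ ≤ _ := by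
        rw [← Finset.sum_div, Finset.sum_add_distrib]
        linarith

lemma one_sub_le_graphProb {n : ℕ} {P : SimpleGraph (Fin n) → Prop}
    {B : Finset (SimpleGraph (Fin n))} {ε : ℝ} (hP : ∀ G, G ∉ B → P G)
    (hB : (B.card : ℝ) ≤ ε * Fintype.card (SimpleGraph (Fin n))) :
    1 - ε ≤ graphProb n P := by
  have hN : (0 : ℝ) < Fintype.card (SimpleGraph (Fin n)) := by
    exact_mod_cast Fintype.card_pos
  have hsub : Bᶜ ⊆ univ.filter P := fun G hG => by
    simpa using hP G (Finset.mem_compl.mp hG)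
  have h1 : (Bᶜ.card : ℝ) ≤ ((univ.filter P).card : ℝ) := by
    exact_mod_cast Finset.card_le_card hsub
  have h2 : (B.card : ℝ) + Bᶜ.card = Fintype.card (SimpleGraph (Fin n)) := by
    exact_mod_cast Finset.card_add_card_compl B
  rw [graphProb, le_div_iff₀ hN]
  linarith

/-- there are absolute constants `C, c > 0` such that for every `n`, with
probability at least `1 - 2exp(-cn)`, all pairs of disjoint vertex subsets `S`, `T` of
`G(n,1/2)` satisfy the four stated discrepancy bounds. -/
theorem statement10 :
    ∃ C : ℝ, 0 < C ∧ ∃ c : ℝ, 0 < c ∧ ∀ n : ℕ,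
      1 - 2 * Real.exp (-c * n) ≤
        graphProb n (fun G => ∀ S T : Finset (Fin n), Disjoint S T →
          (∑ v ∈ T, ((degIn G S v : ℝ) - (S.card : ℝ) / 2) ^ 2 ≤ C * (n : ℝ) ^ 2) ∧
          (∑ v ∈ T, ((degIn G T v : ℝ) - ((T.card : ℝ) - 1) / 2) ^ 2 ≤ C * (n : ℝ) ^ 2) ∧
          (|∑ v ∈ T, ((degIn G S v : ℝ) - (S.card : ℝ) / 2)| ≤ C * (n : ℝ) ^ (3 / 2 : ℝ)) ∧
          (|∑ v ∈ T, ((degIn G T v : ℝ) - ((T.card : ℝ) - 1) / 2)| ≤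
            C * (n : ℝ) ^ (3 / 2 : ℝ))) := by
  refine ⟨10, by norm_num, 1, one_pos, fun n => ?_⟩
  rcases Nat.eq_zero_or_pos n with rfl | hn
  · refine le_trans (b := 0) (by norm_num) ?_
    unfold graphProb
    positivity
  let B₁ (S : Finset (Fin n)) := univ.filter fun G : SimpleGraph (Fin n) =>
    10 * (n : ℝ) ^ 2 < ∑ v, (∑ w ∈ S with v < w, adjSign G v w) ^ 2
  let B₂ (S : Finset (Fin n)) := univ.filter fun G : SimpleGraph (Fin n) =>
    10 * (n : ℝ) ^ 2 < ∑ v, (∑ w ∈ S with w < v, adjSign G v w) ^ 2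
  refine one_sub_le_graphProb (B := univ.biUnion fun S => B₁ S ∪ B₂ S) ?_ ?_
  · intro G hG S T hST
    simp only [Finset.mem_biUnion, Finset.mem_univ, true_and, not_exists, Finset.mem_union,
      not_or, B₁, B₂, Finset.mem_filter, not_lt] at hG
    have key := fun S' => sum_degIn_sub_half_sq_le (hG S').1 (hG S').2 T
    have hS : ∑ v ∈ T, ((degIn G S v : ℝ) - (S.card : ℝ) / 2) ^ 2 ≤ 10 * (n : ℝ) ^ 2 := by
      refine le_of_eq_of_le (Finset.sum_congr rfl fun v hv => ?_) (key S)
      rw [Finset.erase_eq_of_notMem (Finset.disjoint_right.mp hST hv)]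
    have hT : ∑ v ∈ T, ((degIn G T v : ℝ) - ((T.card : ℝ) - 1) / 2) ^ 2 ≤
        10 * (n : ℝ) ^ 2 := by
      refine le_of_eq_of_le (Finset.sum_congr rfl fun v hv => ?_) (key T)
      rw [Finset.cast_card_erase_of_mem hv]
    exact ⟨hS, hT, abs_sum_le_rpow_of_sum_sq_le T _ hS, abs_sum_le_rpow_of_sum_sq_le T _ hT⟩
  · set N : ℝ := ((Fintype.card (SimpleGraph (Fin n)) : ℕ) : ℝ)
    have h1 (S : Finset (Fin n)) : ((B₁ S).card : ℝ) ≤ Real.exp (-2 * n) * N :=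
      card_filter_stars_sq_le hn (fun v => S.filter fun w => v < w) fun v w h h' =>
        lt_asymm (Finset.mem_filter.mp h).2 (Finset.mem_filter.mp h').2
    have h2 (S : Finset (Fin n)) : ((B₂ S).card : ℝ) ≤ Real.exp (-2 * n) * N :=
      card_filter_stars_sq_le hn (fun v => S.filter fun w => w < v) fun v w h h' =>
        lt_asymm (Finset.mem_filter.mp h).2 (Finset.mem_filter.mp h').2
    have hpow : (2 : ℝ) ^ n ≤ Real.exp n := by
      rw [← mul_one (n : ℝ), Real.exp_nat_mul]
      gcongr
      linarith [Real.add_one_le_exp (1 : ℝ)]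
    calc ((univ.biUnion fun S => B₁ S ∪ B₂ S).card : ℝ)
        ≤ ∑ S : Finset (Fin n), ((B₁ S ∪ B₂ S).card : ℝ) := by
          exact_mod_cast Finset.card_biUnion_le
      _ ≤ ∑ _S : Finset (Fin n), 2 * (Real.exp (-2 * n) * N) := by
          refine Finset.sum_le_sum fun S _ => ?_
          have : ((B₁ S ∪ B₂ S).card : ℝ) ≤ (B₁ S).card + (B₂ S).card := by
            exact_mod_cast Finset.card_union_le _ _
          linarith [h1 S, h2 S]
      _ = 2 ^ n * (2 * (Real.exp (-2 * n) * N)) := by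
          simp
      _ ≤ Real.exp n * (2 * (Real.exp (-2 * n) * N)) := by gcongr
      _ = 2 * (Real.exp n * Real.exp (-2 * n)) * N := by ring
      _ = 2 * Real.exp (-1 * n) * N := by
          rw [← Real.exp_add]
          ring_nf
end

section
/- Let a₁,…,a_n ∈ ℝ, let 0 ≤ s ≤ n be an integer, and let X = Σ_{i=1}^n a_i ξ_i, where ξ = (ξ₁,…,ξ_n) is uniformly distributed on the set of binary vectors in {0,1}^n with exactly s ones. Set η² = Σ_{i=1}^n a_i² − (Σ_{i=1}^n a_i)²/n. Then for all t ≥ 0, P(|X−E[X]| ≥ t) ≤ 2exp(−t²/(4η²)); moreover, there is an absolute constant C such that E[e^{X−E[X]}] ≤ 2e^{Cη²}. -/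
open Finset

open scoped Classical

/-- The expectation of `f` with respect to the uniform measure on the "slice" of the Boolean
hypercube `{0,1}^n` consisting of vectors with exactly `s` ones (identified with the
`s`-element subsets of `Fin n`). -/
noncomputable def sliceExp (n s : ℕ) (f : Finset (Fin n) → ℝ) : ℝ :=
  (∑ T ∈ Finset.powersetCard s (univ : Finset (Fin n)), f T) /
    ((Finset.powersetCard s (univ : Finset (Fin n))).card : ℝ)

/-- The probability of the event `E` with respect to the uniform measure on the slice. -/
noncomputable def sliceProb (n s : ℕ) (E : Finset (Fin n) → Prop) : ℝ :=
  (((Finset.powersetCard s (univ : Finset (Fin n))).filter E).card : ℝ) /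
    ((Finset.powersetCard s (univ : Finset (Fin n))).card : ℝ)

/-- Sums over the `(k + 1)`-subsets of `insert x S` split by whether the subset contains `x`. -/
lemma sum_powersetCard_succ_insert {ι : Type*} [DecidableEq ι] {x : ι} {S : Finset ι}
    (hx : x ∉ S) (k : ℕ) (a : ι → ℝ) (g : ℝ → ℝ) :
    ∑ T ∈ powersetCard (k + 1) (insert x S), g (∑ i ∈ T, a i) =
      ∑ T ∈ powersetCard (k + 1) S, g (∑ i ∈ T, a i) +
        ∑ T ∈ powersetCard k S, g (a x + ∑ i ∈ T, a i) := by
  have hmem : ∀ {j : ℕ} {T : Finset ι}, T ∈ powersetCard j S → x ∉ T := fun hT hxT =>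
    hx ((mem_powersetCard.1 hT).1 hxT)
  rw [powersetCard_succ_insert hx, sum_union, sum_image]
  · congr 1
    exact sum_congr rfl fun T hT => by rw [sum_insert (hmem hT)]
  · intro T hT T' hT' h
    rw [← erase_insert (hmem hT), ← erase_insert (hmem hT'), h]
  · rw [disjoint_left]
    intro T hT hT'
    obtain ⟨U, -, rfl⟩ := mem_image.1 hT'
    exact hmem hT (mem_insert_self x U)

/-- The sum of the squared deviations of `a` from its mean over `S`. -/
noncomputable def sumSqDev {ι : Type*} (S : Finset ι) (a : ι → ℝ) : ℝ :=
  (∑ i ∈ S, a i ^ 2) - (∑ i ∈ S, a i) ^ 2 / (#S : ℝ)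

lemma sumSqDev_nonneg {ι : Type*} (S : Finset ι) (a : ι → ℝ) : 0 ≤ sumSqDev S a := by
  rw [sumSqDev, sub_nonneg]
  refine div_le_of_le_mul₀ (by positivity) (by positivity) ?_
  rw [mul_comm]
  exact sq_sum_le_card_mul_sum_sq

lemma sumSqDev_const_mul {ι : Type*} (S : Finset ι) (a : ι → ℝ) (c : ℝ) :
    sumSqDev S (fun i => c * a i) = c ^ 2 * sumSqDev S a := by
  simp only [sumSqDev, mul_pow, ← mul_sum]
  ring

/-- How the mean changes when a point is inserted. -/
lemma mean_insert {ι : Type*} [DecidableEq ι] {x : ι} {S : Finset ι} (hx : x ∉ S) (a : ι → ℝ) :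
    (∑ i ∈ insert x S, a i) / (#(insert x S) : ℝ) =
      (∑ i ∈ S, a i) / (#S : ℝ) + (a x - (∑ i ∈ S, a i) / (#S : ℝ)) / ((#S : ℝ) + 1) := by
  rw [sum_insert hx, card_insert_of_notMem hx]
  rcases S.eq_empty_or_nonempty with rfl | hS
  · simp
  · have : (0 : ℝ) < #S := by exact_mod_cast hS.card_pos
    push_cast
    field_simp
    ring

lemma sumSqDev_insert {ι : Type*} [DecidableEq ι] {x : ι} {S : Finset ι} (hx : x ∉ S)
    (hS : S.Nonempty) (a : ι → ℝ) :
    sumSqDev (insert x S) a = sumSqDev S a +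
      (#S : ℝ) / (#S + 1) * (a x - (∑ i ∈ S, a i) / (#S : ℝ)) ^ 2 := by
  have : (0 : ℝ) < #S := by exact_mod_cast hS.card_pos
  rw [sumSqDev, sumSqDev, sum_insert hx, sum_insert hx, card_insert_of_notMem hx]
  push_cast
  field_simp
  ring

/-- A centered Bernoulli variable scaled by `d` has moment generating function at most
`exp (d ^ 2 / 2)`. -/
lemma bernoulli_mgf_le {p : ℝ} (hp0 : 0 ≤ p) (hp1 : p ≤ 1) (d : ℝ) :
    (1 - p) * Real.exp (-(p * d)) + p * Real.exp ((1 - p) * d) ≤ Real.exp (d ^ 2 / 2) := by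
  set A := (1 - p) * Real.exp (-(p * d)) + p * Real.exp ((1 - p) * d) with hA
  have hq : 0 ≤ 1 - p := by linarith
  have hA0 : 0 ≤ A := by positivity
  have hB : 1 ≤ (1 - p) * Real.exp (p * d) + p * Real.exp (-((1 - p) * d)) := by
    have h1 := mul_le_mul_of_nonneg_left (Real.add_one_le_exp (p * d)) hq
    have h2 := mul_le_mul_of_nonneg_left (Real.add_one_le_exp (-((1 - p) * d))) hp0
    nlinarith
  have hcosh : 1 ≤ Real.cosh d := Real.one_le_cosh d
  have hAB : A * ((1 - p) * Real.exp (p * d) + p * Real.exp (-((1 - p) * d))) =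
      (1 - p) ^ 2 + p ^ 2 + 2 * (p * (1 - p)) * Real.cosh d := by
    have h1 : Real.exp (-(p * d)) * Real.exp (p * d) = 1 := by simp [← Real.exp_add]
    have h2 : Real.exp ((1 - p) * d) * Real.exp (-((1 - p) * d)) = 1 := by simp [← Real.exp_add]
    have h3 : Real.exp (-(p * d)) * Real.exp (-((1 - p) * d)) = Real.exp (-d) := by
      rw [← Real.exp_add]; ring_nf
    have h4 : Real.exp ((1 - p) * d) * Real.exp (p * d) = Real.exp d := by
      rw [← Real.exp_add]; ring_nf
    rw [Real.cosh_eq, hA]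
    linear_combination (1 - p) ^ 2 * h1 + p ^ 2 * h2 + p * (1 - p) * h3 + p * (1 - p) * h4
  calc A ≤ A * ((1 - p) * Real.exp (p * d) + p * Real.exp (-((1 - p) * d))) :=
        le_mul_of_one_le_right hA0 hB
    _ ≤ Real.cosh d := by
        rw [hAB]
        nlinarith [sq_nonneg (1 - p), sq_nonneg p, mul_nonneg hp0 hq]
    _ ≤ Real.exp (d ^ 2 / 2) := Real.cosh_le_exp_half_sq d

lemma choose_eq_mul_choose_succ (m k : ℕ) :
    (m.choose k : ℝ) = ((k : ℝ) + 1) / (m + 1) * ((m + 1).choose (k + 1) : ℝ) := by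
  have h : ((m : ℝ) + 1) * m.choose k = (m + 1).choose (k + 1) * ((k : ℝ) + 1) := by
    exact_mod_cast Nat.add_one_mul_choose_eq m k
  field_simp
  linarith

lemma choose_succ_eq_mul_choose_succ (m k : ℕ) :
    (m.choose (k + 1) : ℝ) =
      (1 - ((k : ℝ) + 1) / (m + 1)) * ((m + 1).choose (k + 1) : ℝ) := by
  have h : ((m + 1).choose (k + 1) : ℝ) = m.choose k + m.choose (k + 1) := by
    exact_mod_cast Nat.choose_succ_succ m k
  have := choose_eq_mul_choose_succ m k
  linarith

/-- The sum of `a` over a uniformly random `s`-subset of `S` has mean `s` times the mean of `a`. -/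
lemma sum_powersetCard_sub_mean {ι : Type*} [DecidableEq ι] (a : ι → ℝ) (S : Finset ι) (s : ℕ) :
    ∑ T ∈ powersetCard s S, ((∑ i ∈ T, a i) - s * ((∑ i ∈ S, a i) / (#S : ℝ))) = 0 := by
  induction S using Finset.induction_on generalizing s with
  | empty =>
    cases s with
    | zero => simp
    | succ k => simp [powersetCard_eq_empty.2 (show #(∅ : Finset ι) < k + 1 by simp)]
  | insert x S hx ih =>
    cases s with
    | zero => simp
    | succ k =>
      have h0 := ih k
      have h1 := ih (k + 1)
      rw [mean_insert hx]
      refine (sum_powersetCard_succ_insert hx k a (fun y => y - (k + 1 : ℕ) * _)).trans ?_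
      simp only [sum_sub_distrib, sum_add_distrib, sum_const, card_powersetCard, nsmul_eq_mul]
        at h0 h1 ⊢
      rw [choose_eq_mul_choose_succ #S k] at h0 ⊢
      rw [choose_succ_eq_mul_choose_succ #S k] at h1 ⊢
      push_cast at h0 h1 ⊢
      set N : ℝ := ((#S + 1).choose (k + 1) : ℝ)
      linear_combination h0 + h1

/-- The centered sum of `a` over a uniformly random `s`-subset of `S` has moment generating
function at most `exp (sumSqDev S a)`. -/
lemma sum_powersetCard_exp_le {ι : Type*} [DecidableEq ι] (a : ι → ℝ) (S : Finset ι) (s : ℕ) :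
    ∑ T ∈ powersetCard s S, Real.exp ((∑ i ∈ T, a i) - s * ((∑ i ∈ S, a i) / (#S : ℝ))) ≤
      ((#S).choose s : ℝ) * Real.exp (sumSqDev S a) := by
  induction S using Finset.induction_on generalizing s with
  | empty =>
    cases s with
    | zero => simp [sumSqDev]
    | succ k => simp [powersetCard_eq_empty.2 (show #(∅ : Finset ι) < k + 1 by simp)]
  | insert x S hx ih =>
    rcases s with _ | k
    · simpa using sumSqDev_nonneg (insert x S) a
    rcases S.eq_empty_or_nonempty with rfl | hS
    · rcases k with _ | k
      · simp [sumSqDev, powersetCard_one]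
      · rw [powersetCard_eq_empty.2 (by simp), sum_empty]
        positivity
    rcases lt_or_ge (#S) k with hk | hk
    · rw [powersetCard_eq_empty.2 (by rw [card_insert_of_notMem hx]; omega), sum_empty]
      positivity
    have hm : (1 : ℝ) ≤ #S := by exact_mod_cast hS.card_pos
    have hkm : (k : ℝ) ≤ #S := by exact_mod_cast hk
    have h0 := ih k
    have h1 := ih (k + 1)
    rw [mean_insert hx, sumSqDev_insert hx hS, card_insert_of_notMem hx]
    refine (sum_powersetCard_succ_insert hx k a
      (fun y => Real.exp (y - (k + 1 : ℕ) * _))).trans_le ?_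
    set μ : ℝ := (∑ i ∈ S, a i) / (#S : ℝ)
    set d : ℝ := a x - μ with hd
    set p : ℝ := ((k : ℝ) + 1) / (#S + 1) with hp
    have hp0 : 0 ≤ p := by positivity
    have hp1 : p ≤ 1 := by rw [hp, div_le_one (by positivity)]; linarith
    have hpd : ((k : ℝ) + 1) * (d / (#S + 1)) = p * d := by rw [hp]; ring
    have e1 : ∀ T : Finset ι,
        Real.exp ((∑ i ∈ T, a i) - (k + 1 : ℕ) * (μ + d / ((#S : ℝ) + 1))) =
          Real.exp (-(p * d)) * Real.exp ((∑ i ∈ T, a i) - (k + 1 : ℕ) * μ) := by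
      intro T
      rw [← Real.exp_add]
      congr 1
      push_cast
      linear_combination -hpd
    have e2 : ∀ T : Finset ι,
        Real.exp (a x + (∑ i ∈ T, a i) - (k + 1 : ℕ) * (μ + d / ((#S : ℝ) + 1))) =
          Real.exp ((1 - p) * d) * Real.exp ((∑ i ∈ T, a i) - k * μ) := by
      intro T
      rw [← Real.exp_add]
      congr 1
      push_cast
      linear_combination -hpd - hd
    simp only [e1, e2, ← mul_sum]
    rw [choose_eq_mul_choose_succ] at h0
    rw [choose_succ_eq_mul_choose_succ] at h1
    rw [← hp] at h0 h1
    set N : ℝ := ((#S + 1).choose (k + 1) : ℝ)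
    have hfrac : d ^ 2 / 2 ≤ (#S : ℝ) / (#S + 1) * d ^ 2 := by
      have : (1 : ℝ) / 2 ≤ (#S : ℝ) / (#S + 1) := by
        rw [div_le_div_iff₀ (by norm_num) (by positivity)]; linarith
      nlinarith [sq_nonneg d]
    calc _ ≤ Real.exp (-(p * d)) * ((1 - p) * N * Real.exp (sumSqDev S a)) +
          Real.exp ((1 - p) * d) * (p * N * Real.exp (sumSqDev S a)) := by gcongr
      _ = N * Real.exp (sumSqDev S a) *
          ((1 - p) * Real.exp (-(p * d)) + p * Real.exp ((1 - p) * d)) := by ring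
      _ ≤ N * Real.exp (sumSqDev S a) * Real.exp (d ^ 2 / 2) := by
          gcongr
          exact bernoulli_mgf_le hp0 hp1 d
      _ ≤ N * Real.exp (sumSqDev S a) * Real.exp ((#S : ℝ) / (#S + 1) * d ^ 2) := by gcongr
      _ = _ := by rw [Real.exp_add]; ring

lemma sliceExp_sum {n s : ℕ} (hs : s ≤ n) (a : Fin n → ℝ) :
    sliceExp n s (fun T => ∑ i ∈ T, a i) = s * ((∑ i, a i) / n) := by
  have hN : (0 : ℝ) < n.choose s := by exact_mod_cast Nat.choose_pos hs
  have h := sum_powersetCard_sub_mean a univ s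
  rw [sum_sub_distrib, sum_const, card_powersetCard, card_univ, Fintype.card_fin,
    nsmul_eq_mul] at h
  rw [sliceExp, card_powersetCard, card_univ, Fintype.card_fin, div_eq_iff hN.ne']
  linarith

/-- The moment generating function of a centered linear form on the slice is at most that of a
Gaussian of variance `2 * sumSqDev univ a`. -/
lemma sum_exp_mul_sub_sliceExp_le {n s : ℕ} (hs : s ≤ n) (a : Fin n → ℝ) (c : ℝ) :
    ∑ T ∈ powersetCard s (univ : Finset (Fin n)),
      Real.exp (c * ((∑ i ∈ T, a i) - sliceExp n s (fun T' => ∑ i ∈ T', a i))) ≤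
        (n.choose s : ℝ) * Real.exp (c ^ 2 * sumSqDev univ a) := by
  have h := sum_powersetCard_exp_le (fun i => c * a i) univ s
  rw [sumSqDev_const_mul, card_univ, Fintype.card_fin] at h
  rw [sliceExp_sum hs]
  refine le_of_eq_of_le (sum_congr rfl fun T _ => ?_) h
  rw [← mul_sum, ← mul_sum]
  ring_nf

/-- concentration on a slice of the hypercube: for `X = ∑ a_i ξ_i` with
`ξ` uniform on the slice of sum `s`, writing `η² = ∑ a_i² - (∑ a_i)²/n`, we have the
subgaussian tail bound `P(|X - E[X]| ≥ t) ≤ 2exp(-t²/(4η²))` for all `t ≥ 0`, and moreover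
`E[e^{X - E[X]}] ≤ 2e^{Cη²}` for an absolute constant `C`. -/
theorem statement12 :
    ∃ C : ℝ, 0 < C ∧ ∀ (n : ℕ) (a : Fin n → ℝ) (s : ℕ), s ≤ n →
      (∀ t : ℝ, 0 ≤ t →
        sliceProb n s (fun T =>
            t ≤ |(∑ i ∈ T, a i) - sliceExp n s (fun T' => ∑ i ∈ T', a i)|) ≤
          2 * Real.exp (-(t ^ 2) / (4 * ((∑ i, (a i) ^ 2) - (∑ i, a i) ^ 2 / n)))) ∧
      sliceExp n s (fun T =>
          Real.exp ((∑ i ∈ T, a i) - sliceExp n s (fun T' => ∑ i ∈ T', a i))) ≤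
        2 * Real.exp (C * ((∑ i, (a i) ^ 2) - (∑ i, a i) ^ 2 / n)) := by
  refine ⟨1, one_pos, fun n a s hs => ?_⟩
  have hη : (∑ i, (a i) ^ 2) - (∑ i, a i) ^ 2 / n = sumSqDev univ a := by simp [sumSqDev]
  have hη0 := sumSqDev_nonneg univ a
  have hN : (0 : ℝ) < n.choose s := by exact_mod_cast Nat.choose_pos hs
  have hcard : (#(powersetCard s (univ : Finset (Fin n))) : ℝ) = n.choose s := by
    rw [card_powersetCard, card_univ, Fintype.card_fin]
  have hmgf := sum_exp_mul_sub_sliceExp_le hs a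
  rw [hη]
  set v := sumSqDev univ a
  set μ := sliceExp n s (fun T' => ∑ i ∈ T', a i)
  constructor
  · intro t ht
    rw [sliceProb, hcard, div_le_iff₀ hN]
    set F := (powersetCard s (univ : Finset (Fin n))).filter (fun T => t ≤ |(∑ i ∈ T, a i) - μ|)
      with hF
    rcases hη0.eq_or_lt with hv | hv
    · have hle : (#F : ℝ) ≤ n.choose s := by
        rw [← hcard]
        exact_mod_cast card_filter_le _ _
      rw [← hv]
      simp only [mul_zero, div_zero, Real.exp_zero]
      linarith
    set c := t / (2 * v) with hc
    have hc0 : 0 ≤ c := by positivity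
    have hmarkov : (#F : ℝ) * Real.exp (c * t) ≤
        2 * (n.choose s * Real.exp (c ^ 2 * v)) := by
      calc (#F : ℝ) * Real.exp (c * t) = ∑ T ∈ F, Real.exp (c * t) := by
            rw [sum_const, nsmul_eq_mul]
        _ ≤ ∑ T ∈ F, (Real.exp (c * ((∑ i ∈ T, a i) - μ)) +
              Real.exp (-c * ((∑ i ∈ T, a i) - μ))) := by
            refine sum_le_sum fun T hT => ?_
            have hT' := (mem_filter.1 hT).2
            rcases le_abs.1 hT' with h | h
            · exact (Real.exp_le_exp.2 (mul_le_mul_of_nonneg_left h hc0)).trans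
                (le_add_of_nonneg_right (Real.exp_pos _).le)
            · refine (Real.exp_le_exp.2 ?_).trans (le_add_of_nonneg_left (Real.exp_pos _).le)
              linarith [mul_le_mul_of_nonneg_left h hc0]
        _ ≤ ∑ T ∈ powersetCard s (univ : Finset (Fin n)),
              (Real.exp (c * ((∑ i ∈ T, a i) - μ)) +
                Real.exp (-c * ((∑ i ∈ T, a i) - μ))) :=
            sum_le_sum_of_subset_of_nonneg (filter_subset _ _) fun _ _ _ => by positivity
        _ ≤ 2 * (n.choose s * Real.exp (c ^ 2 * v)) := by
            rw [sum_add_distrib]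
            have h1 := hmgf c
            have h2 := hmgf (-c)
            rw [neg_sq] at h2
            linarith
    have hexp : Real.exp (c ^ 2 * v) =
        Real.exp (-(t ^ 2) / (4 * v)) * Real.exp (c * t) := by
      rw [← Real.exp_add, hc]
      congr 1
      field_simp
      ring
    rw [hexp] at hmarkov
    refine le_of_mul_le_mul_right ?_ (Real.exp_pos (c * t))
    linarith
  · have h := hmgf 1
    simp only [one_mul, one_pow] at h
    rw [sliceExp, hcard, div_le_iff₀ hN, one_mul]
    have := mul_pos hN (Real.exp_pos v)
    linarith
end

section
/- For every K>0 there exist C>0 and m₀ such that the following holds for all m ≥ m₀. Let e and d be integers, set Δ₁ = e − m(m−1)/4 and Δ₂ = (m−1)/2 − d, and suppose |Δ₁| ≤ K m^{3/2} and |Δ₂| ≤ K√(m log m). Then the ratio [C(m(m−1)/2, e)·C(m(m−1), 2e)^{−1}] / [C((m−1)(m−2)/2, e−d)·C((m−1)(m−2), 2e−2d)^{−1}] equals (1+θ)·2^{−(m−1)}·exp(−8(Δ₁² + Δ₁Δ₂m)/m³) for some real θ with |θ| ≤ C m^{−2/5}. -/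
open Finset

/-- The logarithm of `(2 n)! / n!`. -/
noncomputable def logFactorialRatio (n : ℕ) : ℝ :=
  Real.log ((2 * n).factorial : ℝ) - Real.log (n.factorial : ℝ)

lemma log_choose_mul_inv_choose_two_mul {N e : ℕ} (h : e ≤ N) :
    Real.log ((N.choose e : ℝ) * ((2 * N).choose (2 * e) : ℝ)⁻¹) =
      logFactorialRatio e + logFactorialRatio (N - e) - logFactorialRatio N := by
  have hf : ∀ n : ℕ, (n.factorial : ℝ) ≠ 0 := fun n => by exact_mod_cast n.factorial_ne_zero
  have h2 : 2 * N - 2 * e = 2 * (N - e) := by omega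
  rw [Nat.cast_choose ℝ h, Nat.cast_choose ℝ (by omega : 2 * e ≤ 2 * N), h2]
  unfold logFactorialRatio
  rw [Real.log_mul, Real.log_inv, Real.log_div, Real.log_div, Real.log_mul, Real.log_mul]
  · ring
  all_goals simp [hf]

lemma logFactorialRatio_succ (n : ℕ) :
    logFactorialRatio (n + 1) = logFactorialRatio n + Real.log 4 + Real.log (n + 1 / 2) := by
  have hf : ∀ n : ℕ, (n.factorial : ℝ) ≠ 0 := fun n => by exact_mod_cast n.factorial_ne_zero
  have h0 : (n : ℝ) + 1 ≠ 0 := by positivity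
  have h1 : (n : ℝ) + 1 / 2 ≠ 0 := by positivity
  unfold logFactorialRatio
  have e1 : (((2 * (n + 1)).factorial : ℕ) : ℝ)
      = 4 * (n + 1 / 2) * (n + 1) * ((2 * n).factorial : ℝ) := by
    rw [show 2 * (n + 1) = 2 * n + 1 + 1 by ring, Nat.factorial_succ, Nat.factorial_succ]
    push_cast
    ring
  rw [e1, Nat.factorial_succ, Nat.cast_mul, Nat.cast_succ, Real.log_mul (by positivity) (hf _),
    Real.log_mul (by positivity) h0, Real.log_mul (by norm_num) h1, Real.log_mul h0 (hf _)]
  ring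

lemma abs_log_half_sub_mul_log_le {n : ℕ} (hn : 0 < n) :
    |Real.log (n + 1 / 2) - ((n + 1) * Real.log (n + 1) - n * Real.log n) + 1| ≤
      1 / ((n : ℝ) + 1) := by
  have hn' : (0 : ℝ) < n := by exact_mod_cast hn
  have a1 := Real.log_le_sub_one_of_pos (show (0 : ℝ) < (n + 1) / n by positivity)
  have a2 := Real.one_sub_inv_le_log_of_pos (show (0 : ℝ) < (n + 1) / n by positivity)
  have b1 := Real.log_le_sub_one_of_pos (show (0 : ℝ) < (n + 1 / 2) / (n + 1) by positivity)
  have b2 := Real.one_sub_inv_le_log_of_pos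
    (show (0 : ℝ) < (n + 1 / 2) / (n + 1) by positivity)
  rw [Real.log_div (by positivity) (by positivity)] at a1 a2 b1 b2
  have c1 := mul_le_mul_of_nonneg_left a1 hn'.le
  have c2 := mul_le_mul_of_nonneg_left a2 hn'.le
  have d1 : (n : ℝ) * ((n + 1) / n - 1) = 1 := by field_simp; ring
  have d2 : (n : ℝ) * (1 - ((n + 1 : ℝ) / n)⁻¹) = 1 - 1 / (n + 1) := by field_simp; ring
  have d3 : ((n : ℝ) + 1 / 2) / (n + 1) - 1 ≤ 0 := by
    rw [sub_nonpos, div_le_one (by positivity)]; linarith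
  have d4 : -(1 / ((n : ℝ) + 1)) ≤ 1 - (((n : ℝ) + 1 / 2) / (n + 1))⁻¹ := by
    have : 1 - (((n : ℝ) + 1 / 2) / (n + 1))⁻¹ + 1 / (n + 1) = n / ((2 * n + 1) * (n + 1)) := by
      field_simp; ring
    have : 0 ≤ (n : ℝ) / ((2 * n + 1) * (n + 1)) := by positivity
    linarith
  rw [d1] at c1
  rw [d2] at c2
  rw [abs_le]
  constructor <;> linarith

lemma abs_logFactorialRatio_sub_le {a : ℕ} (ha : 0 < a) (k : ℕ) :
    |logFactorialRatio (a + k) - logFactorialRatio a -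
      (((a + k : ℕ) : ℝ) * Real.log ((a + k : ℕ) : ℝ) - a * Real.log a +
        k * (Real.log 4 - 1))| ≤ k / (a : ℝ) := by
  have ha' : (0 : ℝ) < a := by exact_mod_cast ha
  induction k with
  | zero => simp
  | succ k ih =>
    have h := abs_log_half_sub_mul_log_le (n := a + k) (by omega)
    rw [← add_assoc, logFactorialRatio_succ]
    have h3 : 1 / (((a + k : ℕ) : ℝ) + 1) ≤ 1 / a := by
      apply one_div_le_one_div_of_le ha'
      push_cast
      have : (0 : ℝ) ≤ k := by positivity
      linarith
    have h4 : ((k + 1 : ℕ) : ℝ) / a = k / a + 1 / a := by push_cast; ring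
    rw [h4]
    push_cast at *
    rw [abs_le] at *
    constructor <;> linarith

/-- `t ↦ (1 + t) log (1 + t) + (1 - t) log (1 - t) - t ^ 2`, the entropy function centred at `1/2`
without its quadratic part. -/
noncomputable def entropyRemainder (t : ℝ) : ℝ :=
  (1 + t) * Real.log (1 + t) + (1 - t) * Real.log (1 - t) - t ^ 2

lemma entropyRemainder_zero : entropyRemainder 0 = 0 := by simp [entropyRemainder]

lemma hasDerivAt_entropyRemainder {t : ℝ} (h : |t| < 1) :
    HasDerivAt entropyRemainder (Real.log (1 + t) - Real.log (1 - t) - 2 * t) t := by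
  obtain ⟨h1, h2⟩ := abs_lt.1 h
  have p : HasDerivAt (fun t : ℝ => 1 + t) 1 t := (hasDerivAt_id t).const_add 1
  have q : HasDerivAt (fun t : ℝ => 1 - t) (-1) t := (hasDerivAt_id t).const_sub 1
  have p1 : 1 + t ≠ 0 := by linarith
  have q1 : 1 - t ≠ 0 := by linarith
  refine HasDerivAt.congr_deriv (f := entropyRemainder)
    (((p.mul (p.log p1)).add (q.mul (q.log q1))).sub ((hasDerivAt_id t).pow 2)) ?_
  simp only [id, Nat.cast_ofNat]
  field_simp
  ring

lemma abs_log_sub_log_sub_le {t : ℝ} (h : |t| ≤ 1 / 2) :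
    |Real.log (1 + t) - Real.log (1 - t) - 2 * t| ≤ 4 * |t| ^ 3 := by
  have a := Real.abs_log_sub_add_sum_range_le (show |t| < 1 by linarith) 2
  have b := Real.abs_log_sub_add_sum_range_le (show |-t| < 1 by rw [abs_neg]; linarith) 2
  have c : |t| ^ (2 + 1) / (1 - |t|) ≤ 2 * |t| ^ 3 := by
    rw [div_le_iff₀ (by linarith), show 2 + 1 = 3 from rfl]
    nlinarith [mul_nonneg (pow_nonneg (abs_nonneg t) 3) (sub_nonneg.2 h)]
  rw [abs_neg] at b
  replace a := abs_le.1 (a.trans c)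
  replace b := abs_le.1 (b.trans c)
  simp only [Finset.sum_range_succ, Finset.sum_range_zero] at a b
  norm_num at a b
  rw [abs_le]
  constructor <;> linarith [a.1, a.2, b.1, b.2]

lemma abs_entropyRemainder_sub_le {τ t u : ℝ} (hτ : τ ≤ 1 / 2) (ht : |t| ≤ τ) (hu : |u| ≤ τ) :
    |entropyRemainder t - entropyRemainder u| ≤ 4 * τ ^ 3 * |t - u| := by
  have := Convex.norm_image_sub_le_of_norm_hasDerivWithin_le (f := entropyRemainder)
    (f' := fun t => Real.log (1 + t) - Real.log (1 - t) - 2 * t) (s := Set.Icc (-τ) τ)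
    (C := 4 * τ ^ 3) (x := u) (y := t)
    (fun x hx => (hasDerivAt_entropyRemainder
      (by linarith [abs_le.2 hx])).hasDerivWithinAt)
    (fun x hx => by
      have hx' := abs_le.2 hx
      refine (abs_log_sub_log_sub_le (hx'.trans hτ)).trans ?_
      gcongr) (convex_Icc _ _) (abs_le.1 hu) (abs_le.1 ht)
  simpa [Real.norm_eq_abs] using this

lemma mul_log_add_mul_log_sub_mul_log {N x : ℝ} (hN : 0 < N) (hx : |2 * x / N| < 1) :
    (N / 2 + x) * Real.log (N / 2 + x) + (N / 2 - x) * Real.log (N / 2 - x) - N * Real.log N =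
      -N * Real.log 2 + 2 * x ^ 2 / N + N / 2 * entropyRemainder (2 * x / N) := by
  obtain ⟨h1, h2⟩ := abs_lt.1 hx
  have e1 : N / 2 + x = N / 2 * (1 + 2 * x / N) := by field_simp
  have e2 : N / 2 - x = N / 2 * (1 - 2 * x / N) := by field_simp
  have l1 : Real.log (N / 2 + x) = Real.log N - Real.log 2 + Real.log (1 + 2 * x / N) := by
    rw [e1, Real.log_mul (by positivity) (by linarith), Real.log_div hN.ne' (by norm_num)]
  have l2 : Real.log (N / 2 - x) = Real.log N - Real.log 2 + Real.log (1 - 2 * x / N) := by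
    rw [e2, Real.log_mul (by positivity) (by linarith), Real.log_div hN.ne' (by norm_num)]
  rw [l1, l2]
  unfold entropyRemainder
  field_simp
  ring

lemma abs_log_choose_ratio_sub_le {a b : ℕ} (ha : 0 < a) (hb : 0 < b) (k l : ℕ) :
    |logFactorialRatio (a + k) + logFactorialRatio (b + l) - logFactorialRatio (a + b + (k + l)) -
      (logFactorialRatio a + logFactorialRatio b - logFactorialRatio (a + b)) -
      (((a + k : ℝ) * Real.log (a + k) + (b + l) * Real.log (b + l) -
          (a + k + (b + l)) * Real.log (a + k + (b + l))) -
        (a * Real.log a + b * Real.log b - (a + b) * Real.log (a + b)))| ≤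
      k / (a : ℝ) + l / (b : ℝ) + (k + l) / (a + b : ℝ) := by
  have h1 := abs_le.1 (abs_logFactorialRatio_sub_le ha k)
  have h2 := abs_le.1 (abs_logFactorialRatio_sub_le hb l)
  have h3 := abs_le.1 (abs_logFactorialRatio_sub_le (show 0 < a + b by omega) (k + l))
  push_cast at h1 h2 h3
  rw [show (a + b + (k + l) : ℝ) = a + k + (b + l) by ring] at h3
  rw [abs_le]
  constructor <;> linarith [h1.1, h1.2, h2.1, h2.2, h3.1, h3.2]

lemma abs_quadratic_part_le {K s x y : ℝ} (hK : 0 < K) (hs : 2 ≤ s)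
    (hx : |x| ≤ K * s ^ 6) (hy : |y| ≤ K * s ^ 3) :
    |4 * x ^ 2 / (s ^ 4 * (s ^ 4 - 1)) - 4 * (x + y) ^ 2 / ((s ^ 4 - 1) * (s ^ 4 - 2)) +
      8 * (x ^ 2 + x * y * s ^ 4) / (s ^ 4) ^ 3| ≤ 400 * K ^ 2 / s ^ 2 := by
  have hM : 16 ≤ s ^ 4 := by nlinarith [pow_le_pow_left₀ (by norm_num) hs 4]
  have hs0 : 0 < s := by linarith
  have e : 4 * x ^ 2 / (s ^ 4 * (s ^ 4 - 1)) - 4 * (x + y) ^ 2 / ((s ^ 4 - 1) * (s ^ 4 - 2)) +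
      8 * (x ^ 2 + x * y * s ^ 4) / (s ^ 4) ^ 3 =
      (-(3 * s ^ 4 - 2) * (8 * x ^ 2 + 8 * x * y * s ^ 4) - 4 * y ^ 2 * (s ^ 4) ^ 3) /
        ((s ^ 4) ^ 3 * ((s ^ 4 - 1) * (s ^ 4 - 2))) := by
    have h1 : s ^ 4 - 1 ≠ 0 := by linarith
    have h2 : s ^ 4 - 2 ≠ 0 := by linarith
    generalize s ^ 4 = M at *
    have : M ≠ 0 := by linarith
    field_simp
    ring
  have hden : s ^ 20 / 2 ≤ (s ^ 4) ^ 3 * ((s ^ 4 - 1) * (s ^ 4 - 2)) := by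
    have : (s ^ 4) ^ 2 / 2 ≤ (s ^ 4 - 1) * (s ^ 4 - 2) := by nlinarith
    calc s ^ 20 / 2 = (s ^ 4) ^ 3 * ((s ^ 4) ^ 2 / 2) := by ring
      _ ≤ _ := by gcongr
  have hx2 : x ^ 2 ≤ K ^ 2 * s ^ 12 := by
    rw [← sq_abs]; calc |x| ^ 2 ≤ (K * s ^ 6) ^ 2 := by gcongr
      _ = _ := by ring
  have hy2 : y ^ 2 ≤ K ^ 2 * s ^ 6 := by
    rw [← sq_abs]; calc |y| ^ 2 ≤ (K * s ^ 3) ^ 2 := by gcongr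
      _ = _ := by ring
  have hxy : |x * y| ≤ K ^ 2 * s ^ 9 := by
    rw [abs_mul]; calc |x| * |y| ≤ (K * s ^ 6) * (K * s ^ 3) := by gcongr
      _ = _ := by ring
  have p1 : s ^ 12 ≤ s ^ 14 := pow_le_pow_right₀ (by linarith) (by norm_num)
  have p2 : s ^ 13 ≤ s ^ 14 := pow_le_pow_right₀ (by linarith) (by norm_num)
  have hnum : |-(3 * s ^ 4 - 2) * (8 * x ^ 2 + 8 * x * y * s ^ 4) - 4 * y ^ 2 * (s ^ 4) ^ 3| ≤
      52 * K ^ 2 * s ^ 18 := by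
    have q1 : |8 * x ^ 2 + 8 * x * y * s ^ 4| ≤ 16 * K ^ 2 * s ^ 14 := by
      calc _ ≤ |8 * x ^ 2| + |8 * x * y * s ^ 4| := abs_add_le _ _
        _ = 8 * x ^ 2 + 8 * |x * y| * s ^ 4 := by
          rw [abs_of_nonneg (by positivity : 0 ≤ 8 * x ^ 2), mul_assoc 8 x y, abs_mul, abs_mul,
            abs_of_nonneg (by positivity : 0 ≤ s ^ 4)]
          norm_num
        _ ≤ 8 * (K ^ 2 * s ^ 12) + 8 * (K ^ 2 * s ^ 9) * s ^ 4 := by gcongr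
        _ = 8 * (K ^ 2 * s ^ 12) + 8 * (K ^ 2 * s ^ 13) := by ring
        _ ≤ 8 * (K ^ 2 * s ^ 14) + 8 * (K ^ 2 * s ^ 14) := by gcongr
        _ = _ := by ring
    calc _ ≤ |-(3 * s ^ 4 - 2) * (8 * x ^ 2 + 8 * x * y * s ^ 4)| + |4 * y ^ 2 * (s ^ 4) ^ 3| :=
          abs_sub _ _
      _ = (3 * s ^ 4 - 2) * |8 * x ^ 2 + 8 * x * y * s ^ 4| + 4 * y ^ 2 * (s ^ 4) ^ 3 := by
          rw [abs_mul, abs_neg, abs_of_nonneg (by linarith : 0 ≤ 3 * s ^ 4 - 2),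
            abs_of_nonneg (by positivity : 0 ≤ 4 * y ^ 2 * (s ^ 4) ^ 3)]
      _ ≤ (3 * s ^ 4) * (16 * K ^ 2 * s ^ 14) + 4 * (K ^ 2 * s ^ 6) * (s ^ 4) ^ 3 := by
          gcongr
          linarith
      _ = _ := by ring
  rw [e, abs_div, abs_of_pos (lt_of_lt_of_le (by positivity) hden), div_le_div_iff₀
    (lt_of_lt_of_le (by positivity) hden) (by positivity)]
  calc _ ≤ 52 * K ^ 2 * s ^ 18 * s ^ 2 := by gcongr
    _ ≤ 400 * K ^ 2 * (s ^ 20 / 2) := by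
      have : 0 ≤ K ^ 2 * s ^ 20 := by positivity
      nlinarith
    _ ≤ _ := by gcongr

lemma abs_remainder_part_le {K s x y : ℝ} (hK : 0 < K) (hs : 2 ≤ s) (hsK : 32 * K ≤ s ^ 2)
    (hx : |x| ≤ K * s ^ 6) (hy : |y| ≤ K * s ^ 3) :
    |4 * x / (s ^ 4 * (s ^ 4 - 1))| ≤ 16 * K / s ^ 2 ∧
    |4 * (x + y) / ((s ^ 4 - 1) * (s ^ 4 - 2))| ≤ 16 * K / s ^ 2 ∧
    |s ^ 4 * (s ^ 4 - 1) / 4 * entropyRemainder (4 * x / (s ^ 4 * (s ^ 4 - 1))) -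
      (s ^ 4 - 1) * (s ^ 4 - 2) / 4 *
        entropyRemainder (4 * (x + y) / ((s ^ 4 - 1) * (s ^ 4 - 2)))| ≤
      4 * (16 * K) ^ 4 / s ^ 2 := by
  have hM : 16 ≤ s ^ 4 := by nlinarith [pow_le_pow_left₀ (by norm_num) hs 4]
  have hs0 : 0 < s := by linarith
  have hden : s ^ 8 / 2 ≤ (s ^ 4 - 1) * (s ^ 4 - 2) := by
    rw [show s ^ 8 = (s ^ 4) ^ 2 by ring]; nlinarith
  have hden' : s ^ 8 / 2 ≤ s ^ 4 * (s ^ 4 - 1) := by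
    rw [show s ^ 8 = (s ^ 4) ^ 2 by ring]; nlinarith
  have h36 : s ^ 3 ≤ s ^ 6 := pow_le_pow_right₀ (by linarith) (by norm_num)
  have hy6 : |y| ≤ K * s ^ 6 := hy.trans (by gcongr)
  have hτ : 16 * K / s ^ 2 ≤ 1 / 2 := by
    rw [div_le_iff₀ (by positivity)]; linarith
  have hd0 : 0 < (s ^ 4 - 1) * (s ^ 4 - 2) := lt_of_lt_of_le (by positivity) hden
  have hd0' : 0 < s ^ 4 * (s ^ 4 - 1) := lt_of_lt_of_le (by positivity) hden'
  have ht : |4 * x / (s ^ 4 * (s ^ 4 - 1))| ≤ 16 * K / s ^ 2 := by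
    rw [abs_div, abs_of_pos hd0', div_le_div_iff₀ hd0' (by positivity), abs_mul]
    norm_num
    calc 4 * |x| * s ^ 2 ≤ 4 * (K * s ^ 6) * s ^ 2 := by gcongr
      _ ≤ 16 * K * (s ^ 8 / 2) := by
        have : 0 ≤ K * s ^ 8 := by positivity
        nlinarith
      _ ≤ _ := by gcongr
  have hu : |4 * (x + y) / ((s ^ 4 - 1) * (s ^ 4 - 2))| ≤ 16 * K / s ^ 2 := by
    rw [abs_div, abs_of_pos hd0, div_le_div_iff₀ hd0 (by positivity), abs_mul]
    norm_num
    calc 4 * |x + y| * s ^ 2 ≤ 4 * (K * s ^ 6 + K * s ^ 6) * s ^ 2 := by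
          gcongr
          exact (abs_add_le _ _).trans (add_le_add hx hy6)
      _ = 16 * K * (s ^ 8 / 2) := by ring
      _ ≤ _ := by gcongr
  refine ⟨ht, hu, ?_⟩
  have hdiff : |4 * x / (s ^ 4 * (s ^ 4 - 1)) - 4 * (x + y) / ((s ^ 4 - 1) * (s ^ 4 - 2))| ≤
      24 * K / s ^ 5 := by
    have e : 4 * x / (s ^ 4 * (s ^ 4 - 1)) - 4 * (x + y) / ((s ^ 4 - 1) * (s ^ 4 - 2)) =
        -(8 * x + 4 * y * s ^ 4) / (s ^ 4 * ((s ^ 4 - 1) * (s ^ 4 - 2))) := by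
      have h1 : s ^ 4 - 1 ≠ 0 := by linarith
      have h2 : s ^ 4 - 2 ≠ 0 := by linarith
      generalize s ^ 4 = M at *
      have : M ≠ 0 := by linarith
      field_simp
      ring
    have hd : 0 < s ^ 4 * ((s ^ 4 - 1) * (s ^ 4 - 2)) := by positivity
    rw [e, abs_div, abs_of_pos hd, abs_neg, div_le_div_iff₀ hd (by positivity)]
    have h67 : s ^ 6 ≤ s ^ 7 := pow_le_pow_right₀ (by linarith) (by norm_num)
    calc |8 * x + 4 * y * s ^ 4| * s ^ 5 ≤ (8 * |x| + 4 * |y| * s ^ 4) * s ^ 5 := by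
          gcongr
          refine (abs_add_le _ _).trans_eq ?_
          rw [abs_mul, abs_mul, abs_mul, abs_of_pos (by positivity : 0 < s ^ 4)]
          norm_num
      _ ≤ (8 * (K * s ^ 7) + 4 * (K * s ^ 3) * s ^ 4) * s ^ 5 := by
          gcongr
          exact hx.trans (by gcongr)
      _ = 24 * K * (s ^ 4 * (s ^ 8 / 2)) := by ring
      _ ≤ _ := by gcongr
  have r1 := abs_entropyRemainder_sub_le hτ ht hu
  have r2 := abs_entropyRemainder_sub_le hτ ht (u := 0) (by rw [abs_zero]; positivity)
  rw [entropyRemainder_zero, sub_zero, sub_zero] at r2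
  generalize 4 * x / (s ^ 4 * (s ^ 4 - 1)) = t at *
  generalize 4 * (x + y) / ((s ^ 4 - 1) * (s ^ 4 - 2)) = u at *
  have e : s ^ 4 * (s ^ 4 - 1) / 4 * entropyRemainder t -
      (s ^ 4 - 1) * (s ^ 4 - 2) / 4 * entropyRemainder u = (s ^ 4 - 1) / 2 * entropyRemainder t +
      (s ^ 4 - 1) * (s ^ 4 - 2) / 4 * (entropyRemainder t - entropyRemainder u) := by ring
  have hn : (s ^ 4 - 1) * (s ^ 4 - 2) ≤ s ^ 8 := by
    rw [show s ^ 8 = (s ^ 4) ^ 2 by ring]; nlinarith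
  rw [e]
  calc _ ≤ |(s ^ 4 - 1) / 2 * entropyRemainder t| +
        |(s ^ 4 - 1) * (s ^ 4 - 2) / 4 * (entropyRemainder t - entropyRemainder u)| :=
        abs_add_le _ _
    _ = (s ^ 4 - 1) / 2 * |entropyRemainder t| +
        (s ^ 4 - 1) * (s ^ 4 - 2) / 4 * |entropyRemainder t - entropyRemainder u| := by
        rw [abs_mul, abs_mul, abs_of_pos (by linarith : 0 < (s ^ 4 - 1) / 2),
          abs_of_pos (by linarith : 0 < (s ^ 4 - 1) * (s ^ 4 - 2) / 4)]
    _ ≤ s ^ 4 / 2 * (4 * (16 * K / s ^ 2) ^ 3 * (16 * K / s ^ 2)) +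
        s ^ 8 / 4 * (4 * (16 * K / s ^ 2) ^ 3 * (24 * K / s ^ 5)) := by
        gcongr
        · linarith
        · exact r2.trans (by gcongr)
        · exact r1.trans (by gcongr)
    _ = (16 * K) ^ 4 * (2 / s ^ 4 + 3 / 2 * (1 / s ^ 3)) := by
        field_simp
        ring
    _ ≤ (16 * K) ^ 4 * (2 * (1 / s ^ 2) + 3 / 2 * (1 / s ^ 2)) := by
        have h2 : 1 / s ^ 4 ≤ 1 / s ^ 2 :=
          one_div_le_one_div_of_le (by positivity) (pow_le_pow_right₀ (by linarith) (by norm_num))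
        have h3 : 1 / s ^ 3 ≤ 1 / s ^ 2 :=
          one_div_le_one_div_of_le (by positivity) (pow_le_pow_right₀ (by linarith) (by norm_num))
        rw [show 2 / s ^ 4 = 2 * (1 / s ^ 4) by ring]
        gcongr
    _ ≤ _ := by
        have : 0 ≤ (16 * K) ^ 4 * (1 / s ^ 2) := by positivity
        rw [show 4 * (16 * K) ^ 4 / s ^ 2 = 4 * ((16 * K) ^ 4 * (1 / s ^ 2)) by ring]
        linarith

lemma sqrt_mul_log_pow_four_le {s : ℝ} (hs : 4 ≤ s) :
    Real.sqrt (s ^ 4 * Real.log (s ^ 4)) ≤ s ^ 3 := by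
  have hl : Real.log (s ^ 4) ≤ s ^ 2 := by
    rw [Real.log_pow]
    have := Real.log_le_sub_one_of_pos (show 0 < s by linarith)
    push_cast
    nlinarith
  refine Real.sqrt_le_iff.2 ⟨by positivity, ?_⟩
  calc s ^ 4 * Real.log (s ^ 4) ≤ s ^ 4 * s ^ 2 := by gcongr
    _ = _ := by ring

/-- The estimate in logarithmic form, with `s ^ 4` in the role of `m`, and with the two parts of a
partition written as `a + k`, `b + l` before and `a`, `b` after the removal. -/
lemma abs_log_ratio_add_le {K s x y : ℝ} (hK : 0 < K) (hs : 2 ≤ s) (hsK : 64 * K ≤ s ^ 2)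
    (hx : |x| ≤ K * s ^ 6) (hy : |y| ≤ K * s ^ 3) {a b k l : ℕ}
    (ha : (a : ℝ) = (s ^ 4 - 1) * (s ^ 4 - 2) / 4 + (x + y))
    (hb : (b : ℝ) = (s ^ 4 - 1) * (s ^ 4 - 2) / 4 - (x + y))
    (hak : (a + k : ℝ) = s ^ 4 * (s ^ 4 - 1) / 4 + x)
    (hbl : (b + l : ℝ) = s ^ 4 * (s ^ 4 - 1) / 4 - x) :
    |logFactorialRatio (a + k) + logFactorialRatio (b + l) - logFactorialRatio (a + b + (k + l)) -
      (logFactorialRatio a + logFactorialRatio b - logFactorialRatio (a + b)) +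
        (s ^ 4 - 1) * Real.log 2 + 8 * (x ^ 2 + x * y * s ^ 4) / (s ^ 4) ^ 3| ≤
      (400 * K ^ 2 + 4 * (16 * K) ^ 4 + 48) / s ^ 2 := by
  have hM : 16 ≤ s ^ 4 := by nlinarith [pow_le_pow_left₀ (by norm_num) hs 4]
  have hs0 : 0 < s := by linarith
  obtain ⟨ht, hu, hR⟩ := abs_remainder_part_le hK hs (by linarith) hx hy
  have hQ := abs_quadratic_part_le hK hs hx hy
  have hτ : 16 * K / s ^ 2 < 1 := by
    rw [div_lt_one (by positivity)]; nlinarith [pow_pos hs0 2]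
  have hxy : |x + y| ≤ s ^ 8 / 32 := by
    have h36 : s ^ 3 ≤ s ^ 6 := pow_le_pow_right₀ (by linarith) (by norm_num)
    calc |x + y| ≤ K * s ^ 6 + K * s ^ 6 :=
          (abs_add_le _ _).trans (add_le_add hx (hy.trans (by gcongr)))
      _ = 64 * K * s ^ 6 / 32 := by ring
      _ ≤ s ^ 2 * s ^ 6 / 32 := by gcongr
      _ = _ := by ring
  have hden : s ^ 8 / 2 ≤ (s ^ 4 - 1) * (s ^ 4 - 2) := by
    rw [show s ^ 8 = (s ^ 4) ^ 2 by ring]; nlinarith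
  obtain ⟨hxy1, hxy2⟩ := abs_le.1 hxy
  have hs8 : 0 < s ^ 8 := by positivity
  have ha' : s ^ 8 / 16 ≤ a := by linarith
  have hb' : s ^ 8 / 16 ≤ b := by linarith
  have hkl : (k + l : ℝ) = s ^ 4 - 1 := by linear_combination hak + hbl - ha - hb
  have hk0 : (0 : ℝ) ≤ k := by positivity
  have hl0 : (0 : ℝ) ≤ l := by positivity
  have hG := abs_log_choose_ratio_sub_le (a := a) (b := b)
    (by exact_mod_cast (show (0 : ℝ) < a by linarith))
    (by exact_mod_cast (show (0 : ℝ) < b by linarith)) k l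
  have hE : (k / (a : ℝ) + l / (b : ℝ) + (k + l) / (a + b : ℝ)) ≤ 48 / s ^ 2 := by
    have h24 : s ^ 2 ≤ s ^ 4 := pow_le_pow_right₀ (by linarith) (by norm_num)
    calc _ ≤ s ^ 4 / (s ^ 8 / 16) + s ^ 4 / (s ^ 8 / 16) + s ^ 4 / (s ^ 8 / 16) := by
          gcongr <;> linarith
      _ = 48 / s ^ 4 := by field_simp; ring
      _ ≤ _ := by gcongr
  have eN : s ^ 4 * (s ^ 4 - 1) / 2 / 2 = s ^ 4 * (s ^ 4 - 1) / 4 := by ring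
  have eN' : (s ^ 4 - 1) * (s ^ 4 - 2) / 2 / 2 = (s ^ 4 - 1) * (s ^ 4 - 2) / 4 := by ring
  have et : 2 * x / (s ^ 4 * (s ^ 4 - 1) / 2) = 4 * x / (s ^ 4 * (s ^ 4 - 1)) := by
    rw [div_div_eq_mul_div]; ring
  have eu : 2 * (x + y) / ((s ^ 4 - 1) * (s ^ 4 - 2) / 2) =
      4 * (x + y) / ((s ^ 4 - 1) * (s ^ 4 - 2)) := by
    rw [div_div_eq_mul_div]; ring
  have q1 : 2 * x ^ 2 / (s ^ 4 * (s ^ 4 - 1) / 2) = 4 * x ^ 2 / (s ^ 4 * (s ^ 4 - 1)) := by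
    rw [div_div_eq_mul_div]; ring
  have q2 : 2 * (x + y) ^ 2 / ((s ^ 4 - 1) * (s ^ 4 - 2) / 2) =
      4 * (x + y) ^ 2 / ((s ^ 4 - 1) * (s ^ 4 - 2)) := by
    rw [div_div_eq_mul_div]; ring
  have f1 := mul_log_add_mul_log_sub_mul_log (N := s ^ 4 * (s ^ 4 - 1) / 2) (x := x)
    (by have := mul_pos (by linarith : 0 < s ^ 4) (by linarith : 0 < s ^ 4 - 1); linarith)
    (by rw [et]; linarith)
  have f2 := mul_log_add_mul_log_sub_mul_log (N := (s ^ 4 - 1) * (s ^ 4 - 2) / 2) (x := x + y)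
    (by linarith) (by rw [eu]; linarith)
  rw [eN, et, q1, ← hak, ← hbl, show s ^ 4 * (s ^ 4 - 1) / 2 = (a + k + (b + l) : ℝ) by
    rw [hak, hbl]; ring] at f1
  rw [eN', eu, q2, ← ha, ← hb, show (s ^ 4 - 1) * (s ^ 4 - 2) / 2 = (a + b : ℝ) by
    rw [ha, hb]; ring] at f2
  rw [f1, f2] at hG
  have hl2 : (a + k + (b + l) : ℝ) * Real.log 2 = (a + b : ℝ) * Real.log 2 +
      (s ^ 4 - 1) * Real.log 2 := by rw [← hkl]; ring
  have hsplit : (400 * K ^ 2 + 4 * (16 * K) ^ 4 + 48) / s ^ 2 =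
      400 * K ^ 2 / s ^ 2 + 4 * (16 * K) ^ 4 / s ^ 2 + 48 / s ^ 2 := by ring
  rw [hsplit]
  replace hG := abs_le.1 (hG.trans hE)
  rw [abs_le] at hR hQ ⊢
  constructor <;> linarith [hG.1, hG.2, hR.1, hR.2, hQ.1, hQ.2]

/-- an estimate for a ratio of binomial coefficients. -/
theorem statement14 (K : ℝ) (hK : 0 < K) :
    ∃ C : ℝ, 0 < C ∧ ∃ m₀ : ℕ, ∀ m : ℕ, m₀ ≤ m → ∀ e d : ℕ,
      |(e : ℝ) - (m : ℝ) * ((m : ℝ) - 1) / 4| ≤ K * (m : ℝ) ^ (3 / 2 : ℝ) →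
      |((m : ℝ) - 1) / 2 - (d : ℝ)| ≤ K * Real.sqrt ((m : ℝ) * Real.log m) →
      ∃ θ : ℝ, |θ| ≤ C * (m : ℝ) ^ (-(2 : ℝ) / 5) ∧
        (((m * (m - 1) / 2).choose e : ℝ) * ((m * (m - 1)).choose (2 * e) : ℝ)⁻¹) /
            ((((m - 1) * (m - 2) / 2).choose (e - d) : ℝ) *
              (((m - 1) * (m - 2)).choose (2 * e - 2 * d) : ℝ)⁻¹) =
          (1 + θ) * (2 : ℝ) ^ (-((m : ℝ) - 1)) *
            Real.exp (-8 * (((e : ℝ) - (m : ℝ) * ((m : ℝ) - 1) / 4) ^ 2 +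
              ((e : ℝ) - (m : ℝ) * ((m : ℝ) - 1) / 4) * (((m : ℝ) - 1) / 2 - (d : ℝ)) * m) /
              (m : ℝ) ^ 3) := by
  obtain ⟨C, hC⟩ : ∃ C : ℝ, C = 400 * K ^ 2 + 4 * (16 * K) ^ 4 + 48 := ⟨_, rfl⟩
  have hC0 : 0 < C := by rw [hC]; positivity
  obtain ⟨n, hn⟩ := exists_nat_ge (4 + 64 * K + C)
  refine ⟨2 * C, by positivity, n ^ 4, fun m hm e d hx hy => ?_⟩
  obtain ⟨s, hs⟩ : ∃ s : ℝ, s = (m : ℝ) ^ (1 / 4 : ℝ) := ⟨_, rfl⟩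
  have hm0 : (0 : ℝ) ≤ m := by positivity
  have hs0 : 0 ≤ s := by rw [hs]; positivity
  have hms : (m : ℝ) = s ^ 4 := by
    rw [hs, ← Real.rpow_natCast, ← Real.rpow_mul hm0]; norm_num
  have hns : (n : ℝ) ≤ s := by
    have : (n : ℝ) ^ 4 ≤ s ^ 4 := by rw [← hms]; exact_mod_cast hm
    exact (pow_le_pow_iff_left₀ (by positivity) hs0 (by norm_num)).1 this
  have hs4 : 4 ≤ s := by linarith
  have hss : s ≤ s ^ 2 := by nlinarith
  have hM : 256 ≤ s ^ 4 := by nlinarith [pow_le_pow_left₀ (by norm_num) hs4 4]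
  have h32 : (m : ℝ) ^ (3 / 2 : ℝ) = s ^ 6 := by
    rw [hs, ← Real.rpow_natCast, ← Real.rpow_mul hm0]; norm_num
  have h25 : 1 / s ^ 2 ≤ (m : ℝ) ^ (-(2 : ℝ) / 5) := by
    rw [one_div, hs, ← Real.rpow_natCast, ← Real.rpow_mul hm0, ← Real.rpow_neg hm0]
    exact Real.rpow_le_rpow_of_exponent_le (by linarith) (by norm_num)
  have hm2 : 2 ≤ m := by exact_mod_cast (show (2 : ℝ) ≤ m by linarith)
  rw [h32] at hx
  replace hy : |((m : ℝ) - 1) / 2 - (d : ℝ)| ≤ K * s ^ 3 := by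
    refine hy.trans ?_
    rw [hms]
    gcongr
    exact sqrt_mul_log_pow_four_le hs4
  rw [hms] at hx hy ⊢
  obtain ⟨x, hxdef⟩ : ∃ x : ℝ, x = (e : ℝ) - s ^ 4 * (s ^ 4 - 1) / 4 := ⟨_, rfl⟩
  obtain ⟨y, hydef⟩ : ∃ y : ℝ, y = (s ^ 4 - 1) / 2 - (d : ℝ) := ⟨_, rfl⟩
  rw [← hxdef] at hx ⊢
  rw [← hydef] at hy ⊢
  have hsK : 64 * K ≤ s ^ 2 := by linarith
  obtain ⟨N, hN⟩ : ∃ N, m * (m - 1) = 2 * N := (Nat.even_mul_pred_self m).two_dvd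
  obtain ⟨N', hN'⟩ : ∃ N, (m - 1) * (m - 2) = 2 * N := (Nat.even_mul_pred_self (m - 1)).two_dvd
  have rN : (N : ℝ) = s ^ 4 * (s ^ 4 - 1) / 2 := by
    have := congrArg (Nat.cast (R := ℝ)) hN
    push_cast [Nat.cast_sub (by omega : 1 ≤ m)] at this
    rw [hms] at this; linarith
  have rN' : (N' : ℝ) = (s ^ 4 - 1) * (s ^ 4 - 2) / 2 := by
    have := congrArg (Nat.cast (R := ℝ)) hN'
    push_cast [Nat.cast_sub (by omega : 1 ≤ m), Nat.cast_sub hm2] at this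
    rw [hms] at this; linarith
  obtain ⟨hx1, hx2⟩ := abs_le.1 hx
  obtain ⟨hy1, hy2⟩ := abs_le.1 hy
  have hK6 : K * s ^ 6 ≤ s ^ 8 / 64 := by
    calc K * s ^ 6 = 64 * K * s ^ 6 / 64 := by ring
      _ ≤ s ^ 2 * s ^ 6 / 64 := by gcongr
      _ = _ := by ring
  have hK3 : K * s ^ 3 ≤ s ^ 4 / 64 := by
    calc K * s ^ 3 = 64 * K * s ^ 3 / 64 := by ring
      _ ≤ s * s ^ 3 / 64 := by gcongr; linarith
      _ = _ := by ring
  have hs8 : 256 * s ^ 4 ≤ s ^ 8 := by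
    calc 256 * s ^ 4 ≤ s ^ 4 * s ^ 4 := by gcongr
      _ = s ^ 8 := by ring
  have hde : d ≤ e := by
    have : (d : ℝ) ≤ e := by
      linarith only [hxdef, hydef, hs8, hM, hx1, hy1, hK6, hK3]
    exact_mod_cast this
  obtain ⟨a, rfl⟩ := Nat.exists_eq_add_of_le' hde
  push_cast at hxdef
  have haN : a ≤ N' := by
    have : (a : ℝ) ≤ N' := by
      linarith only [hxdef, hydef, hs8, hM, hx2, hy2, hK6, hK3, rN']
    exact_mod_cast this
  obtain ⟨b, rfl⟩ := Nat.exists_eq_add_of_le haN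
  push_cast at rN'
  have hdm : a + b + d ≤ N := by
    have : (a + b + d : ℝ) ≤ N := by
      linarith only [rN, rN', hydef, hM, hy1, hK3]
    exact_mod_cast this
  obtain ⟨l, rfl⟩ := Nat.exists_eq_add_of_le hdm
  push_cast at rN
  have key := abs_log_ratio_add_le hK (by linarith) hsK hx hy (a := a) (b := b) (k := d) (l := l)
    (by linarith only [hxdef, hydef]) (by linarith only [hxdef, hydef, rN'])
    (by linarith only [hxdef]) (by linarith only [hxdef, rN])
  rw [← hC] at key
  have c1 := log_choose_mul_inv_choose_two_mul (show a + d ≤ a + b + d + l by omega)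
  have c2 := log_choose_mul_inv_choose_two_mul (show a ≤ a + b by omega)
  rw [show a + b + d + l - (a + d) = b + l by omega,
    show a + b + d + l = a + b + (d + l) by omega] at c1
  rw [show a + b - a = b by omega] at c2
  rw [hN, hN', Nat.mul_div_cancel_left _ two_pos, Nat.mul_div_cancel_left _ two_pos,
    show a + d - d = a by omega, show 2 * (a + d) - 2 * d = 2 * a by omega,
    show a + b + d + l = a + b + (d + l) by omega]
  have pos : ∀ {N e : ℕ}, e ≤ N →
      0 < (N.choose e : ℝ) * ((2 * N).choose (2 * e) : ℝ)⁻¹ := fun {N e} h => by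
    have h1 : 0 < N.choose e := Nat.choose_pos h
    have h2 : 0 < (2 * N).choose (2 * e) := Nat.choose_pos (by omega)
    positivity
  have p1 := pos (show a + d ≤ a + b + (d + l) by omega)
  have p2 := pos (show a ≤ a + b by omega)
  rw [← c1, ← c2, ← Real.log_div p1.ne' p2.ne'] at key
  generalize hQ : ((a + b + (d + l)).choose (a + d) : ℝ) *
    ((2 * (a + b + (d + l))).choose (2 * (a + d)) : ℝ)⁻¹ /
    (((a + b).choose a : ℝ) * ((2 * (a + b)).choose (2 * a) : ℝ)⁻¹) = Q at *
  have hQ0 : 0 < Q := by rw [← hQ]; exact div_pos p1 p2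
  obtain ⟨E, hE⟩ : ∃ E : ℝ, E = Real.log Q + (s ^ 4 - 1) * Real.log 2 +
    8 * (x ^ 2 + x * y * s ^ 4) / (s ^ 4) ^ 3 := ⟨_, rfl⟩
  rw [← hE] at key
  have hCs : C / s ^ 2 ≤ 1 := by
    rw [div_le_one (by positivity)]; linarith
  refine ⟨Real.exp E - 1, ?_, ?_⟩
  · calc |Real.exp E - 1| ≤ 2 * |E| := Real.abs_exp_sub_one_le (key.trans hCs)
      _ ≤ 2 * (C / s ^ 2) := by gcongr
      _ = 2 * C * (1 / s ^ 2) := by ring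
      _ ≤ _ := by rw [hms] at h25; gcongr
  · rw [add_sub_cancel, Real.rpow_def_of_pos two_pos, ← Real.exp_add, ← Real.exp_add]
    rw [← Real.exp_log hQ0]
    congr 1
    rw [hE]
    ring
end

section
/- For every K ≥ 1 there exist C>0 and n₀ such that the following holds for all integers m, n ≥ n₀ with n/K ≤ m ≤ Kn. Let e and d be integers, set Δ₁ = e − mn/2 and Δ₂ = n/2 − d, and suppose |Δ₁| ≤ K m^{3/2} and |Δ₂| ≤ K√(m log m). Then C(mn, e)^{−1}·C((m−1)n, e−d) equals (1+θ)·2^{−n}·exp(−2(2mΔ₁Δ₂ + Δ₁²)/(m²n)) for some real θ with |θ| ≤ C m^{−2/5}. -/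
open Finset

/-- A ratio of binomial coefficients in terms of falling factorials. -/
theorem inv_choose_mul_choose_eq_descFactorial (a b d f : ℕ) :
    ((d + a + (f + b)).choose (d + a) : ℝ)⁻¹ * ((a + b).choose a : ℝ) =
      (d + a).descFactorial d * (f + b).descFactorial f /
        (d + a + (f + b)).descFactorial (d + f) := by
  have h1 := Nat.add_choose_mul_factorial_mul_factorial (f + b) (d + a)
  have h2 := Nat.add_choose_mul_factorial_mul_factorial b a
  have h3 := Nat.factorial_mul_descFactorial (Nat.le_add_right d a)
  have h4 := Nat.factorial_mul_descFactorial (Nat.le_add_right f b)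
  have h5 := Nat.factorial_mul_descFactorial (n := d + a + (f + b)) (k := d + f) (by omega)
  rw [add_comm (f + b)] at h1
  rw [add_comm b a] at h2
  rw [show d + a - d = a by omega] at h3
  rw [show f + b - f = b by omega] at h4
  rw [show d + a + (f + b) - (d + f) = a + b by omega] at h5
  have p1 : (d + a + (f + b)).choose (d + a) ≠ 0 := (Nat.choose_pos (by omega)).ne'
  have p2 : (d + a + (f + b)).descFactorial (d + f) ≠ 0 := by
    rw [Ne, Nat.descFactorial_eq_zero_iff_lt]; omega
  have key : (a + b).choose a * (d + a + (f + b)).descFactorial (d + f) =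
      (d + a).descFactorial d * (f + b).descFactorial f * (d + a + (f + b)).choose (d + a) := by
    have pa := Nat.factorial_pos a
    have pb := Nat.factorial_pos b
    apply Nat.eq_of_mul_eq_mul_left (Nat.mul_pos pa pb)
    calc _ = ((a + b).choose a * b.factorial * a.factorial) *
          (d + a + (f + b)).descFactorial (d + f) := by ring
      _ = (d + a + (f + b)).choose (d + a) * (f + b).factorial * (d + a).factorial := by
          rw [h2, h5, h1]
      _ = _ := by rw [← h3, ← h4]; ring
  rw [inv_mul_eq_div, div_eq_div_iff (by exact_mod_cast p1) (by exact_mod_cast p2)]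
  exact_mod_cast key

theorem abs_log_one_sub_add_le {t : ℝ} (ht : |t| ≤ 1 / 2) :
    |Real.log (1 - t) + t| ≤ 2 * t ^ 2 := by
  have h := Real.abs_log_sub_add_sum_range_le (x := t) (by linarith) 1
  have h2 : t ^ 2 / (1 - |t|) ≤ 2 * t ^ 2 := by
    rw [div_le_iff₀ (by linarith)]
    nlinarith [sq_nonneg t]
  simp at h
  rw [add_comm]
  linarith

theorem abs_log_one_add_sub_log_one_sub_le {x : ℝ} (hx : |x| ≤ 1 / 2) :
    |Real.log (1 + x) - Real.log (1 - x) - 2 * x| ≤ 4 * |x| ^ 3 := by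
  have h := Real.abs_log_sub_add_sum_range_le (x := x) (by linarith) 2
  have h' := Real.abs_log_sub_add_sum_range_le (x := -x) (by rw [abs_neg]; linarith) 2
  have h2 : |x| ^ 3 / (1 - |x|) ≤ 2 * |x| ^ 3 := by
    rw [div_le_iff₀ (by linarith)]
    nlinarith [pow_nonneg (abs_nonneg x) 3]
  simp [Finset.sum_range_succ] at h h'
  norm_num at h h'
  rw [abs_le] at *
  constructor <;> linarith

theorem abs_log_one_add_add_log_one_sub_le {x : ℝ} (hx : |x| ≤ 1 / 2) :
    |Real.log (1 + x) + Real.log (1 - x) + x ^ 2| ≤ 2 * x ^ 4 := by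
  have hx' := abs_le.1 hx
  rw [← Real.log_mul (by linarith) (by linarith), show (1 + x) * (1 - x) = 1 - x ^ 2 by ring]
  have := abs_log_one_sub_add_le (t := x ^ 2) (by rw [abs_of_nonneg (sq_nonneg x)]; nlinarith)
  rwa [← pow_mul] at this

theorem abs_log_descFactorial_sub_le (a k : ℕ) (hk : 2 * k ≤ a) :
    |Real.log (a.descFactorial k) - (k * Real.log a - k ^ 2 / (2 * a))| ≤
      (k : ℝ) / (2 * a) + 2 * (k : ℝ) ^ 3 / (a : ℝ) ^ 2 := by
  induction k with
  | zero => simp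
  | succ k ih =>
    have ih := ih (by omega)
    have ha : (0 : ℝ) < a := by exact_mod_cast (by omega : 0 < a)
    have hka : (k : ℝ) / a ≤ 1 / 2 := by
      rw [div_le_div_iff₀ ha (by norm_num)]; exact_mod_cast (by omega : k * 2 ≤ 1 * a)
    have hk0 : (0 : ℝ) ≤ k / a := by positivity
    have hpos : (a.descFactorial k : ℝ) ≠ 0 := by
      have : a.descFactorial k ≠ 0 := by rw [Ne, Nat.descFactorial_eq_zero_iff_lt]; omega
      exact_mod_cast this
    have hlog : Real.log (a.descFactorial (k + 1)) =
        Real.log a + Real.log (1 - k / a) + Real.log (a.descFactorial k) := by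
      rw [Nat.descFactorial_succ, Nat.cast_mul, Nat.cast_sub (by omega),
        ← Real.log_mul ha.ne' (by linarith), ← Real.log_mul _ hpos]
      · congr 2; field_simp
      · exact mul_ne_zero ha.ne' (by linarith)
    have hb := abs_log_one_sub_add_le (t := (k : ℝ) / a) (by rwa [abs_of_nonneg hk0])
    have e1 : ((k + 1 : ℕ) : ℝ) ^ 2 / (2 * a) = k ^ 2 / (2 * a) + k / a + 1 / (2 * a) := by
      push_cast; field_simp; ring
    have e2 : ((k + 1 : ℕ) : ℝ) / (2 * a) = k / (2 * a) + 1 / (2 * a) := by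
      push_cast; field_simp
    have e3 : 2 * (k : ℝ) ^ 3 / a ^ 2 + 2 * (k / a) ^ 2 ≤ 2 * ((k + 1 : ℕ) : ℝ) ^ 3 / a ^ 2 := by
      rw [div_pow, ← mul_div_assoc, ← add_div]
      gcongr
      push_cast
      nlinarith [sq_nonneg (k : ℝ), (Nat.cast_nonneg k : (0 : ℝ) ≤ k)]
    have e4 : (0 : ℝ) ≤ 1 / (2 * a) := by positivity
    rw [hlog, e1, e2]
    push_cast at *
    rw [abs_le] at *
    constructor <;> linarith

theorem abs_weighted_log_add_le {x y : ℝ} (hx : |x| ≤ 1 / 2) :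
    |(1 - y) * Real.log (1 + x) + (1 + y) * Real.log (1 - x) + x ^ 2 + 2 * x * y| ≤
      2 * x ^ 4 + 4 * (|y| * |x| ^ 3) := by
  have h1 := abs_log_one_add_add_log_one_sub_le hx
  have h2 := mul_le_mul_of_nonneg_left (abs_log_one_add_sub_log_one_sub_le hx) (abs_nonneg y)
  rw [← abs_mul] at h2
  rw [abs_le] at *
  constructor <;> linarith

theorem abs_sq_one_sub_div_one_add_sub_one_le {x y : ℝ} (hx : |x| ≤ 1 / 2) (hy : |y| ≤ 1) :
    |(1 - y) ^ 2 / (1 + x) - 1| ≤ 2 * (3 * |y| + |x|) := by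
  have hx' := abs_le.1 hx
  have hpos : (0 : ℝ) < 1 + x := by linarith
  rw [div_sub_one hpos.ne', abs_div, abs_of_pos hpos, div_le_iff₀ hpos]
  have h1 : |(1 - y) ^ 2 - (1 + x)| ≤ 3 * |y| + |x| := by
    have h2 : y ^ 2 ≤ |y| := by rw [← sq_abs]; nlinarith [abs_nonneg y]
    rw [abs_le]
    constructor <;> nlinarith [neg_abs_le y, le_abs_self y, neg_abs_le x, le_abs_self x]
  nlinarith [abs_nonneg y, abs_nonneg x]

theorem descFactorial_error_le {K m n a k : ℝ} (hK : 1 ≤ K) (hm : 0 < m) (hn : 0 < n)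
    (hnm : n ≤ K * m) (hk0 : 0 ≤ k) (hk : k ≤ n) (ha : m * n / 4 ≤ a) :
    k / (2 * a) + 2 * k ^ 3 / a ^ 2 ≤ 34 * K * (1 / m) := by
  have hmn : 0 < m * n := by positivity
  have h1 : k / (2 * a) ≤ n / (2 * (m * n / 4)) := by gcongr
  have h2 : 2 * k ^ 3 / a ^ 2 ≤ 2 * n ^ 3 / (m * n / 4) ^ 2 := by gcongr
  have h3 : n / (2 * (m * n / 4)) = 2 * (1 / m) := by field_simp; norm_num
  have h4 : 2 * n ^ 3 / (m * n / 4) ^ 2 = 32 * (n / m) * (1 / m) := by field_simp; norm_num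
  have h5 : n / m ≤ K := by rwa [div_le_iff₀ hm]
  have h6 : 0 < 1 / m := by positivity
  nlinarith

theorem log_descFactorial_ratio_estimate {K m n x y : ℝ} {a b d f : ℕ} (hK : 1 ≤ K)
    (hm : 8 ≤ m) (hn : 0 < n) (hnm : n ≤ K * m)
    (hx : |x| ≤ 1 / 2) (hy : |y| ≤ 1)
    (he : ((d + a : ℕ) : ℝ) = m * n / 2 * (1 + x)) (he' : ((f + b : ℕ) : ℝ) = m * n / 2 * (1 - x))
    (hd : (d : ℝ) = n / 2 * (1 - y)) (hf : (f : ℝ) = n / 2 * (1 + y)) :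
    |Real.log ((d + a).descFactorial d) + Real.log ((f + b).descFactorial f) -
        Real.log ((d + a + (f + b)).descFactorial (d + f)) +
        (n * Real.log 2 + n / 2 * x ^ 2 + n * x * y)| ≤
      102 * K * (1 / m) + K * (3 * |y| + |x|) + n / 2 * (2 * x ^ 4 + 4 * (|y| * |x| ^ 3)) := by
  have hx' := abs_le.1 hx
  have hy' := abs_le.1 hy
  have hm0 : 0 < m := by linarith
  have hmn : 0 < m * n := by positivity
  have hN : ((d + a + (f + b) : ℕ) : ℝ) = m * n := by
    rw [Nat.cast_add, he, he']; ring
  have hdf : ((d + f : ℕ) : ℝ) = n := by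
    rw [Nat.cast_add, hd, hf]; ring
  have hdn : (d : ℝ) ≤ n := by rw [hd]; nlinarith
  have hfn : (f : ℝ) ≤ n := by rw [hf]; nlinarith
  have hEl : m * n / 4 ≤ ((d + a : ℕ) : ℝ) := by rw [he]; nlinarith
  have hFl : m * n / 4 ≤ ((f + b : ℕ) : ℝ) := by rw [he']; nlinarith
  have h8 : 8 * n ≤ m * n := by nlinarith
  have k1 : 2 * d ≤ d + a := by
    have : (2 : ℝ) * d ≤ ((d + a : ℕ) : ℝ) := by linarith
    exact_mod_cast this
  have k2 : 2 * f ≤ f + b := by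
    have : (2 : ℝ) * f ≤ ((f + b : ℕ) : ℝ) := by linarith
    exact_mod_cast this
  have A1 := (abs_log_descFactorial_sub_le (d + a) d k1).trans
    (descFactorial_error_le hK hm0 hn hnm (Nat.cast_nonneg d) hdn hEl)
  have A2 := (abs_log_descFactorial_sub_le (f + b) f k2).trans
    (descFactorial_error_le hK hm0 hn hnm (Nat.cast_nonneg f) hfn hFl)
  have A3 := (abs_log_descFactorial_sub_le (d + a + (f + b)) (d + f) (by omega)).trans
    (descFactorial_error_le hK hm0 hn hnm (Nat.cast_nonneg (d + f)) hdf.le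
      (by rw [hN]; linarith))
  have Q1 := abs_sq_one_sub_div_one_add_sub_one_le hx hy
  have Q2 := abs_sq_one_sub_div_one_add_sub_one_le (x := -x) (y := -y) (by rwa [abs_neg])
    (by rwa [abs_neg])
  rw [abs_neg, abs_neg, sub_neg_eq_add, ← sub_eq_add_neg] at Q2
  have W := abs_weighted_log_add_le (y := y) hx
  have hx1 : (0 : ℝ) < 1 + x := by linarith
  have hx2 : (0 : ℝ) < 1 - x := by linarith
  have L1 : Real.log (m * n / 2 * (1 + x)) = Real.log (m * n) - Real.log 2 + Real.log (1 + x) := by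
    rw [Real.log_mul (by positivity) hx1.ne', Real.log_div hmn.ne' (by norm_num)]
  have L2 : Real.log (m * n / 2 * (1 - x)) = Real.log (m * n) - Real.log 2 + Real.log (1 - x) := by
    rw [Real.log_mul (by positivity) hx2.ne', Real.log_div hmn.ne' (by norm_num)]
  rw [he, L1, hd] at A1
  rw [he', L2, hf] at A2
  rw [hN, hdf] at A3
  have q1 : (n / 2 * (1 - y)) ^ 2 / (2 * (m * n / 2 * (1 + x))) =
      n / m / 4 * ((1 - y) ^ 2 / (1 + x) - 1) + n / m / 4 := by field_simp; ring
  have q2 : (n / 2 * (1 + y)) ^ 2 / (2 * (m * n / 2 * (1 - x))) =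
      n / m / 4 * ((1 + y) ^ 2 / (1 - x) - 1) + n / m / 4 := by field_simp; ring
  have q3 : n ^ 2 / (2 * (m * n)) = n / m / 2 := by field_simp
  rw [q1] at A1
  rw [q2] at A2
  rw [q3] at A3
  have hr0 : 0 < n / m := by positivity
  have hr : n / m ≤ K := by rwa [div_le_iff₀ hm0]
  have Q : |n / m / 4 * ((1 - y) ^ 2 / (1 + x) - 1) + n / m / 4 * ((1 + y) ^ 2 / (1 - x) - 1)| ≤
      K * (3 * |y| + |x|) := by
    rw [← mul_add, abs_mul, abs_of_pos (by positivity)]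
    calc n / m / 4 * _ ≤ K / 4 * (2 * (3 * |y| + |x|) + 2 * (3 * |y| + |x|)) := by
          gcongr
          exact (abs_add_le _ _).trans (add_le_add Q1 Q2)
      _ = _ := by ring
  have W' := mul_le_mul_of_nonneg_left W (by positivity : (0 : ℝ) ≤ n / 2)
  rw [← abs_of_pos (by positivity : (0 : ℝ) < n / 2), ← abs_mul,
    abs_of_pos (by positivity : (0 : ℝ) < n / 2)] at W'
  rw [abs_le] at *
  constructor <;> linarith

theorem log_ratio_error_le {K A h m n x y : ℝ} (hK : 1 ≤ K) (hA : 0 ≤ A) (hh : 0 < h) (h1 : h ≤ 1)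
    (hm : m * h ^ 10 = 1) (hnm : n ≤ K * m)
    (hx : |x| ≤ A * h ^ 5) (hy : |y| ≤ A * h ^ 4) :
    102 * K * (1 / m) + K * (3 * |y| + |x|) + n / 2 * (2 * x ^ 4 + 4 * (|y| * |x| ^ 3)) ≤
      (102 * K + 4 * K * A + 3 * K * A ^ 4) * h ^ 4 := by
  have hm' : 1 / m = h ^ 10 := (eq_one_div_of_mul_eq_one_right hm).symm
  have p5 : h ^ 5 ≤ h ^ 4 := pow_le_pow_of_le_one hh.le h1 (by norm_num)
  have p10 : h ^ 10 ≤ h ^ 4 := pow_le_pow_of_le_one hh.le h1 (by norm_num)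
  have p9 : h ^ 9 ≤ h ^ 4 := pow_le_pow_of_le_one hh.le h1 (by norm_num)
  have hm0 : 0 < m := by rw [← one_div_pos, hm']; positivity
  have t1 : 102 * K * (1 / m) ≤ 102 * K * h ^ 4 := by rw [hm']; gcongr
  have t2 : K * (3 * |y| + |x|) ≤ K * (3 * (A * h ^ 4) + A * h ^ 4) := by
    gcongr
    exact hx.trans (by gcongr)
  have t3 : n / 2 * (2 * x ^ 4 + 4 * (|y| * |x| ^ 3)) ≤ 3 * K * A ^ 4 * h ^ 4 := by
    have hx4 : x ^ 4 = |x| ^ 4 := by rw [pow_abs, abs_of_nonneg (by positivity)]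
    calc n / 2 * (2 * x ^ 4 + 4 * (|y| * |x| ^ 3))
        ≤ K * m / 2 * (2 * (A * h ^ 5) ^ 4 + 4 * (A * h ^ 4 * (A * h ^ 5) ^ 3)) := by
          rw [hx4]; gcongr
      _ = K * A ^ 4 * (m * h ^ 10) * (h ^ 10 + 2 * h ^ 9) := by ring
      _ ≤ K * A ^ 4 * (m * h ^ 10) * (h ^ 4 + 2 * h ^ 4) := by rw [hm]; gcongr
      _ = _ := by rw [hm]; ring
  linarith

/-- The ratio of the binomial coefficients in terms of the relative deviations
`x` of `e` from `m * n / 2` and `y` of `d` from `n / 2`. -/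
theorem exists_inv_choose_mul_choose_eq {K m' n' x y : ℝ} {m n e d : ℕ} (hK : 1 ≤ K)
    (hm : m' = m) (hn : n' = n) (hm8 : 8 ≤ m') (hn0 : 0 < n') (hnm : n' ≤ K * m')
    (hx : |x| ≤ 1 / 2) (hy : |y| ≤ 1)
    (he : (e : ℝ) = m' * n' / 2 * (1 + x)) (hd : (d : ℝ) = n' / 2 * (1 - y)) :
    ∃ L : ℝ, |L| ≤ 102 * K * (1 / m') + K * (3 * |y| + |x|) +
        n' / 2 * (2 * x ^ 4 + 4 * (|y| * |x| ^ 3)) ∧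
      ((m * n).choose e : ℝ)⁻¹ * (((m - 1) * n).choose (e - d) : ℝ) =
        Real.exp L * (2 : ℝ) ^ (-n') * Real.exp (-(n' / 2 * x ^ 2 + n' * x * y)) := by
  have hx' := abs_le.1 hx
  have hy' := abs_le.1 hy
  have h8 : 8 * n' ≤ m' * n' := by nlinarith
  obtain ⟨f, hf⟩ : ∃ f, n = d + f := Nat.exists_eq_add_of_le (by
    have : (d : ℝ) ≤ n := by rw [hd, ← hn]; nlinarith
    exact_mod_cast this)
  obtain ⟨a, ha⟩ : ∃ a, e = d + a := Nat.exists_eq_add_of_le (by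
    have : (d : ℝ) ≤ e := by rw [hd, he]; nlinarith
    exact_mod_cast this)
  have hfr : (f : ℝ) = n' / 2 * (1 + y) := by
    have : n' = d + f := by rw [hn, hf]; push_cast; ring
    linarith
  obtain ⟨b, hb⟩ : ∃ b, m * n = e + f + b := Nat.exists_eq_add_of_le (by
    have : (e : ℝ) + f ≤ m * n := by rw [he, hfr, ← hm, ← hn]; nlinarith
    exact_mod_cast this)
  have hN : m * n = d + a + (f + b) := by omega
  have hM : (m - 1) * n = a + b := by rw [Nat.sub_mul, one_mul]; omega
  have hfb : ((f + b : ℕ) : ℝ) = m' * n' / 2 * (1 - x) := by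
    have : m' * n' = e + ((f + b : ℕ) : ℝ) := by
      rw [hm, hn, ← Nat.cast_mul, ← Nat.cast_add, hb, add_assoc]
    linarith
  have key := log_descFactorial_ratio_estimate hK hm8 hn0 hnm hx hy (ha ▸ he) hfb hd hfr
  refine ⟨_, key, ?_⟩
  have pos : ∀ {u v : ℕ}, v ≤ u → (0 : ℝ) < u.descFactorial v := fun {u v} huv => by
    exact_mod_cast Nat.pos_of_ne_zero (by rw [Ne, Nat.descFactorial_eq_zero_iff_lt]; omega)
  rw [hN, hM, ha, Nat.add_sub_cancel_left, inv_choose_mul_choose_eq_descFactorial,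
    Real.rpow_def_of_pos (by norm_num), ← Real.exp_add, ← Real.exp_add]
  rw [← Real.exp_log (div_pos (mul_pos (pos (Nat.le_add_right d a)) (pos (Nat.le_add_right f b)))
    (pos (u := d + a + (f + b)) (v := d + f) (by omega))),
    Real.log_div (mul_pos (pos (Nat.le_add_right d a)) (pos (Nat.le_add_right f b))).ne'
    (pos (by omega)).ne', Real.log_mul (pos (Nat.le_add_right d a)).ne'
    (pos (Nat.le_add_right f b)).ne']
  congr 1
  ring

theorem eventually_log_le_and_mul_rpow_le (B : ℝ) :
    ∀ᶠ m : ℕ in Filter.atTop, Real.log m ≤ (m : ℝ) ^ (1 / 5 : ℝ) ∧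
      B * (m : ℝ) ^ (-(2 : ℝ) / 5) ≤ 1 := by
  have h1 := (isLittleO_log_rpow_atTop (r := 1 / 5) (by norm_num)).bound one_pos
  have h2 : Filter.Tendsto (fun x : ℝ => B * x ^ (-(2 / 5 : ℝ))) Filter.atTop (nhds (B * 0)) :=
    (tendsto_rpow_neg_atTop (by norm_num)).const_mul B
  rw [mul_zero] at h2
  have h3 := h2.eventually_le_const one_pos
  filter_upwards [tendsto_natCast_atTop_atTop.eventually h1,
    tendsto_natCast_atTop_atTop.eventually h3] with m hm hm'
  rw [one_mul, Real.norm_of_nonneg (Real.rpow_nonneg (Nat.cast_nonneg m) _)] at hm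
  refine ⟨(le_abs_self _).trans hm, ?_⟩
  rwa [neg_div]

/-- an estimate for a ratio of binomial coefficients, bipartite version. -/
theorem statement15 (K : ℝ) (hK : 1 ≤ K) :
    ∃ C : ℝ, 0 < C ∧ ∃ n₀ : ℕ, ∀ m n : ℕ, n₀ ≤ m → n₀ ≤ n →
      (n : ℝ) / K ≤ (m : ℝ) → (m : ℝ) ≤ K * n →
      ∀ e d : ℕ,
      |(e : ℝ) - (m : ℝ) * n / 2| ≤ K * (m : ℝ) ^ (3 / 2 : ℝ) →
      |(n : ℝ) / 2 - (d : ℝ)| ≤ K * Real.sqrt ((m : ℝ) * Real.log m) →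
      ∃ θ : ℝ, |θ| ≤ C * (m : ℝ) ^ (-(2 : ℝ) / 5) ∧
        ((m * n).choose e : ℝ)⁻¹ * (((m - 1) * n).choose (e - d) : ℝ) =
          (1 + θ) * (2 : ℝ) ^ (-(n : ℝ)) *
            Real.exp (-2 * (2 * (m : ℝ) * ((e : ℝ) - (m : ℝ) * n / 2) * ((n : ℝ) / 2 - (d : ℝ)) +
              ((e : ℝ) - (m : ℝ) * n / 2) ^ 2) / ((m : ℝ) ^ 2 * n)) := by
  set A : ℝ := 2 * K ^ 2 with hA
  set B : ℝ := 102 * K + 4 * K * A + 3 * K * A ^ 4 with hB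
  have hA0 : 0 < A := by positivity
  have hB0 : 0 < B := by positivity
  have hAB : 2 * A ≤ B := by
    have : 0 ≤ 3 * K * A ^ 4 := by positivity
    nlinarith
  obtain ⟨N, hN⟩ := Filter.eventually_atTop.1 (eventually_log_le_and_mul_rpow_le B)
  refine ⟨2 * B, by positivity, max N 8, fun m n hm hn hnm hmn e d he hd => ?_⟩
  obtain ⟨hlog, hsmall⟩ := hN m ((le_max_left _ _).trans hm)
  have hm8 : (8 : ℝ) ≤ m := by exact_mod_cast (le_max_right _ _).trans hm
  have hn0 : (0 : ℝ) < n := by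
    have : (8 : ℝ) ≤ n := by exact_mod_cast (le_max_right _ _).trans hn
    linarith
  have hm0 : (0 : ℝ) < m := by linarith
  obtain ⟨h, hh⟩ : ∃ h : ℝ, h = (m : ℝ) ^ (-(1 / 10) : ℝ) := ⟨_, rfl⟩
  have hh0 : 0 < h := by rw [hh]; positivity
  have hh1 : h ≤ 1 := by
    rw [hh]; exact Real.rpow_le_one_of_one_le_of_nonpos (by linarith) (by norm_num)
  have hpow : ∀ k : ℕ, h ^ k = (m : ℝ) ^ (-(1 / 10) * k : ℝ) := fun k => by
    rw [hh, Real.rpow_mul hm0.le, Real.rpow_natCast]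
  have h4 : (m : ℝ) ^ (-(2 : ℝ) / 5) = h ^ 4 := by rw [hpow]; norm_num
  have h10 : (m : ℝ) * h ^ 10 = 1 := by
    rw [hpow]; norm_num [Real.rpow_neg_one, hm0.ne']
  have h15 : (m : ℝ) ^ (3 / 2 : ℝ) = m ^ 2 * h ^ 5 := by
    rw [hpow, ← Real.rpow_natCast (m : ℝ) 2, ← Real.rpow_add hm0]; norm_num
  have hsqrt : Real.sqrt (m * Real.log m) ≤ m * h ^ 4 := by
    apply Real.sqrt_le_iff.2 ⟨by positivity, ?_⟩
    calc (m : ℝ) * Real.log m ≤ m * (m : ℝ) ^ (1 / 5 : ℝ) := by gcongr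
      _ = m * (m * h ^ 8) := by
        congr 1
        rw [hpow]
        nth_rewrite 2 [← Real.rpow_one (m : ℝ)]
        rw [← Real.rpow_add hm0]; norm_num
      _ = _ := by ring
  rw [h15] at he
  rw [h4] at hsmall ⊢
  set D₁ : ℝ := (e : ℝ) - (m : ℝ) * n / 2 with hD₁
  set D₂ : ℝ := (n : ℝ) / 2 - (d : ℝ) with hD₂
  have hx : |2 * D₁ / (m * n)| ≤ A * h ^ 5 := by
    rw [abs_div, abs_mul, abs_two, abs_of_pos (by positivity : (0 : ℝ) < m * n),
      div_le_iff₀ (by positivity)]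
    calc 2 * |D₁| ≤ 2 * (K * (m ^ 2 * h ^ 5)) := by gcongr
      _ = 2 * K * m * h ^ 5 * m := by ring
      _ ≤ 2 * K * m * h ^ 5 * (K * n) := by gcongr
      _ = _ := by rw [hA]; ring
  have hy : |2 * D₂ / n| ≤ A * h ^ 4 := by
    rw [abs_div, abs_mul, abs_two, abs_of_pos hn0, div_le_iff₀ hn0]
    calc 2 * |D₂| ≤ 2 * (K * (m * h ^ 4)) := by
          gcongr
          exact hd.trans (by gcongr)
      _ = 2 * K * h ^ 4 * m := by ring
      _ ≤ 2 * K * h ^ 4 * (K * n) := by gcongr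
      _ = _ := by rw [hA]; ring
  have hhalf : A * h ^ 4 ≤ 1 / 2 := by nlinarith [pow_pos hh0 4]
  have h54 : h ^ 5 ≤ h ^ 4 := pow_le_pow_of_le_one hh0.le hh1 (by norm_num)
  have hnm' : (n : ℝ) ≤ K * m := by
    rw [div_le_iff₀ (by linarith)] at hnm; linarith
  obtain ⟨L, hL, heq⟩ := exists_inv_choose_mul_choose_eq (m := m) (n := n) (e := e) (d := d)
    hK rfl rfl hm8 hn0 hnm'
    (hx.trans ((mul_le_mul_of_nonneg_left h54 hA0.le).trans hhalf)) (by linarith [hy])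
    (by field_simp; rw [hD₁]; ring) (by field_simp; rw [hD₂]; ring)
  have hLB := hL.trans (log_ratio_error_le hK hA0.le hh0 hh1 h10 hnm' hx hy)
  rw [← hB] at hLB
  refine ⟨Real.exp L - 1, ?_, ?_⟩
  · have := Real.abs_exp_sub_one_le (hLB.trans hsmall)
    linarith
  · rw [heq, add_sub_cancel]
    congr 2
    field_simp
    ring
end
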